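/- (von Koch) Assume the Riemann hypothesis. Then there exist C > 0 and N₀ such that for all real N ≥ N₀, | π(N) − ∫₂^N dx/ln x | ≤ C·√N·ln N, where π(N) denotes the number of prime numbers ≤ N. -/

import Mathlib

open Filter Topology

/-- Borel–Carathéodory for logarithmic derivatives: a zero-free function on a disc has
logarithmic derivative controlled by its growth relative to the value at the centre. -/
theorem norm_logDeriv_le_of_ne_zero {g : ℂ → ℂ} {r R M : ℝ} (hr : 0 ≤ r) (hrR : r < R)
    (hg : Differentiable ℂ g) (hne : ∀ z ∈ Metric.ball (0 : ℂ) R, g z ≠ 0)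
    (hM : ∀ z ∈ Metric.ball (0 : ℂ) R, ‖g z‖ ≤ M) {z : ℂ} (hz : ‖z‖ ≤ r) :
    ‖logDeriv g z‖ ≤ 8 * R / (R - r) ^ 2 * (Real.log (M / ‖g 0‖) + 1) := by
  have hR : 0 < R := hr.trans_lt hrR
  have h0mem : (0 : ℂ) ∈ Metric.ball (0 : ℂ) R := by simpa using hR
  have hg0 : 0 < ‖g 0‖ := norm_pos_iff.2 (hne 0 h0mem)
  have hMg : 1 ≤ M / ‖g 0‖ := (one_le_div hg0).2 (hM 0 h0mem)
  have hlog : 0 ≤ Real.log (M / ‖g 0‖) := Real.log_nonneg hMg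
  have hdiff : DifferentiableOn ℂ (logDeriv g) (Metric.ball 0 R) := by
    intro w hw
    have h1 : DifferentiableAt ℂ (deriv g) w := (hg.contDiff (n := 2)).differentiable_deriv_two w
    exact (h1.div (hg w) (hne w hw)).differentiableWithinAt
  obtain ⟨F, hF⟩ := hdiff.isExactOn_ball
  set L : ℂ → ℂ := fun w ↦ F w - F 0 with hL
  have hLd : ∀ w ∈ Metric.ball (0 : ℂ) R, HasDerivAt L (logDeriv g w) w := fun w hw ↦
    (hF w hw).sub_const _
  have hLdiff : DifferentiableOn ℂ L (Metric.ball 0 R) := fun w hw ↦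
    (hLd w hw).differentiableAt.differentiableWithinAt
  have hexp : ∀ w ∈ Metric.ball (0 : ℂ) R, g w * Complex.exp (-L w) = g 0 := by
    intro w hw
    have hder : ∀ v ∈ Metric.ball (0 : ℂ) R,
        HasDerivAt (fun v ↦ g v * Complex.exp (-L v)) 0 v := by
      intro v hv
      have h : HasDerivAt (fun v ↦ g v * Complex.exp (-L v)) _ v :=
        (hg v).hasDerivAt.mul (hLd v hv).neg.cexp
      refine h.congr_deriv ?_
      simp only [Pi.neg_apply]
      rw [logDeriv_apply]
      have := hne v hv
      field_simp
      ring
    have := (convex_ball (0 : ℂ) R).is_const_of_fderivWithin_eq_zero (𝕜 := ℂ)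
      (f := fun v ↦ g v * Complex.exp (-L v))
      (fun v hv ↦ (hder v hv).differentiableAt.differentiableWithinAt)
      (fun v hv ↦ by
        rw [fderivWithin_of_isOpen Metric.isOpen_ball hv]
        ext
        simp [(hder v hv).deriv]) hw h0mem
    simpa [hL] using this
  have hre : Set.MapsTo L (Metric.ball 0 R) {w | w.re ≤ Real.log (M / ‖g 0‖) + 1} := by
    intro w hw
    have h1 := congrArg norm (hexp w hw)
    rw [norm_mul, Complex.norm_exp, Complex.neg_re, Real.exp_neg] at h1
    have h2 : Real.exp (L w).re * ‖g 0‖ ≤ M := by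
      rw [← h1]
      have := Real.exp_pos (L w).re
      field_simp
      exact hM w hw
    have h3 : Real.exp (L w).re ≤ M / ‖g 0‖ := (le_div_iff₀ hg0).2 h2
    have h4 := (Real.le_log_iff_exp_le (by linarith)).2 h3
    simp only [Set.mem_ofPred_eq]
    linarith
  set ρ := (R - r) / 2 with hρ
  have hρ0 : 0 < ρ := by rw [hρ]; linarith
  have hLbound : ∀ w ∈ Metric.sphere z ρ,
      ‖L w‖ ≤ 2 * (Real.log (M / ‖g 0‖) + 1) * R / ρ := by
    intro w hw
    have hw1 : ‖w‖ ≤ r + ρ := by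
      have h1 : ‖w - z‖ = ρ := by simpa [dist_eq_norm] using hw
      calc ‖w‖ = ‖z + (w - z)‖ := by ring_nf
        _ ≤ ‖z‖ + ‖w - z‖ := norm_add_le _ _
        _ ≤ r + ρ := by linarith
    have hwR : ‖w‖ < R := by rw [hρ] at hw1; linarith
    refine (Complex.borelCaratheodory_zero (by linarith) hLdiff hre hR
      (by simpa using hwR) (by simp [hL])).trans ?_
    have : ρ ≤ R - ‖w‖ := by rw [hρ] at hw1 ⊢; linarith
    gcongr
  have hsub : Metric.closedBall z ρ ⊆ Metric.ball 0 R := by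
    intro w hw
    have h1 : ‖w - z‖ ≤ ρ := by simpa [dist_eq_norm] using hw
    have : ‖w‖ ≤ ‖z‖ + ‖w - z‖ := by simpa using norm_add_le z (w - z)
    simp only [Metric.mem_ball, dist_zero_right]
    rw [hρ] at h1
    linarith
  have hcauchy := Complex.norm_deriv_le_of_forall_mem_sphere_norm_le hρ0
    (DifferentiableOn.diffContOnCl (by
      rw [closure_ball z hρ0.ne']; exact hLdiff.mono hsub)) hLbound
  rw [(hLd z (hsub (Metric.mem_closedBall_self hρ0.le))).deriv] at hcauchy
  refine hcauchy.trans (le_of_eq ?_)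
  rw [hρ]
  have : R - r ≠ 0 := by linarith
  field_simp
  ring

/-- Removing one zero by a Blaschke factor. -/
theorem exists_blaschke_quotient {f : ℂ → ℂ} {R M : ℝ} {a : ℂ} (ha : ‖a‖ < R)
    (hf : Differentiable ℂ f) (hfa : f a = 0)
    (hM : ∀ z ∈ Metric.sphere (0 : ℂ) R, ‖f z‖ ≤ M) :
    ∃ g : ℂ → ℂ, Differentiable ℂ g ∧ (∀ z ∈ Metric.sphere (0 : ℂ) R, ‖g z‖ ≤ M) ∧
      ∀ z, f z * ((R : ℂ) ^ 2 - (starRingEnd ℂ) a * z) = (z - a) * (R * g z) := by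
  have hR : 0 < R := (norm_nonneg a).trans_lt ha
  have hRc : (R : ℂ) ≠ 0 := by exact_mod_cast hR.ne'
  have hds : Differentiable ℂ (dslope f a) := by
    rw [← differentiableOn_univ, Complex.differentiableOn_dslope (by simp)]
    exact hf.differentiableOn
  have hmul : ∀ z, (z - a) * dslope f a z = f z := fun z ↦ by
    simpa using sub_smul_dslope_of_zero hfa z
  refine ⟨fun z ↦ dslope f a z * ((R : ℂ) ^ 2 - (starRingEnd ℂ) a * z) / R, by fun_prop, ?_, ?_⟩
  · intro z hz
    have hzn : ‖z‖ = R := by simpa using hz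
    have hza : z - a ≠ 0 := by
      intro h
      rw [sub_eq_zero.1 h] at hzn
      linarith
    have key : ‖(R : ℂ) ^ 2 - (starRingEnd ℂ) a * z‖ = R * ‖z - a‖ := by
      have h1 : (R : ℂ) ^ 2 = z * (starRingEnd ℂ) z := by
        rw [Complex.mul_conj, Complex.normSq_eq_norm_sq, hzn]
        push_cast
        ring
      rw [h1, show z * (starRingEnd ℂ) z - (starRingEnd ℂ) a * z
        = z * (starRingEnd ℂ) (z - a) by rw [map_sub]; ring, norm_mul, hzn, RCLike.norm_conj]
    rw [norm_div, norm_mul, key, Complex.norm_real, Real.norm_eq_abs, abs_of_pos hR]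
    have h2 : ‖dslope f a z‖ * (R * ‖z - a‖) / R = ‖f z‖ := by
      rw [← hmul z, norm_mul]
      field_simp
    rw [h2]
    exact hM z hz
  · intro z
    rw [← hmul z]
    field_simp

/-- The logarithmic derivative of a function on a disc is, up to an error controlled by the growth
of the function, the sum of `1 / (z - a)` over the zeros `a` in a smaller disc. -/
theorem exists_zeros_logDeriv_sub_sum_le {r' r R M : ℝ} (hr' : 0 < r') (hr'r : r' < r)
    (hrR : r < R) (n : ℕ) :
    ∀ f : ℂ → ℂ, Differentiable ℂ f → f 0 ≠ 0 →
      (∀ z ∈ Metric.sphere (0 : ℂ) R, ‖f z‖ ≤ M) → M < ‖f 0‖ * (R / r) ^ n →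
      ∃ Z : Multiset ℂ, Multiset.card Z ≤ n ∧ (∀ a ∈ Z, f a = 0 ∧ ‖a‖ ≤ r) ∧
        ∀ z, ‖z‖ ≤ r' → f z ≠ 0 →
          ‖logDeriv f z - (Z.map fun a ↦ (z - a)⁻¹).sum‖ ≤
            8 * r / (r - r') ^ 2 * (Real.log (M / ‖f 0‖) + 1) + n * (1 / (R - r)) := by
  have hr : 0 < r := hr'.trans hr'r
  have hR : 0 < R := hr.trans hrR
  have hmax : ∀ f : ℂ → ℂ, Differentiable ℂ f → (∀ z ∈ Metric.sphere (0 : ℂ) R, ‖f z‖ ≤ M) →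
      ∀ z ∈ Metric.closedBall (0 : ℂ) R, ‖f z‖ ≤ M := by
    intro f hf hM z hz
    refine Complex.norm_le_of_forall_mem_frontier_norm_le Metric.isBounded_ball
      hf.diffContOnCl (U := Metric.ball 0 R) ?_ ?_
    · rwa [frontier_ball _ hR.ne']
    · rwa [closure_ball _ hR.ne']
  induction n with
  | zero =>
    intro f hf h0 hM hlt
    have := hmax f hf hM 0 (by simpa using hR.le)
    simp at hlt
    linarith
  | succ n ih =>
    intro f hf h0 hM hlt
    have hf0 : 0 < ‖f 0‖ := norm_pos_iff.2 h0
    have hM0 : ‖f 0‖ ≤ M := hmax f hf hM 0 (by simpa using hR.le)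
    have hRr : 0 < 1 / (R - r) := one_div_pos.2 (by linarith)
    by_cases hz : ∃ a, ‖a‖ ≤ r ∧ f a = 0
    · obtain ⟨a, har, hfa⟩ := hz
      obtain ⟨g, hg, hgM, hfg⟩ := exists_blaschke_quotient (har.trans_lt hrR) hf hfa hM
      have ha0 : a ≠ 0 := fun h ↦ h0 (h ▸ hfa)
      have ha : 0 < ‖a‖ := norm_pos_iff.2 ha0
      have hat0 : ‖f 0‖ * R = ‖a‖ * ‖g 0‖ := by
        have h := congrArg norm (hfg 0)
        simp only [mul_zero, sub_zero, zero_sub, norm_mul, norm_pow, norm_neg, Complex.norm_real,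
          Real.norm_eq_abs, abs_of_pos hR] at h
        have : R * (‖f 0‖ * R) = R * (‖a‖ * ‖g 0‖) := by linarith
        exact mul_left_cancel₀ hR.ne' this
      have hg0' : ‖f 0‖ * (R / r) ≤ ‖g 0‖ := by
        rw [← mul_div_assoc, div_le_iff₀ hr, hat0, mul_comm]
        gcongr
      have hfg0 : ‖f 0‖ ≤ ‖g 0‖ := by
        refine le_trans ?_ hg0'
        have : 1 ≤ R / r := (one_le_div hr).2 hrR.le
        nlinarith
      have hg0 : g 0 ≠ 0 := norm_pos_iff.1 (hf0.trans_le hfg0)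
      obtain ⟨Z, hZc, hZ, hbound⟩ := ih g hg hg0 hgM (hlt.trans_le (by
        rw [pow_succ', ← mul_assoc]
        gcongr))
      have hden : ∀ z : ℂ, ‖z‖ ≤ r → R * (R - r) ≤ ‖(R : ℂ) ^ 2 - (starRingEnd ℂ) a * z‖ := by
        intro z hz
        have h1 := norm_sub_norm_le ((R : ℂ) ^ 2) ((starRingEnd ℂ) a * z)
        rw [norm_pow, Complex.norm_real, Real.norm_eq_abs, abs_of_pos hR, norm_mul,
          RCLike.norm_conj] at h1
        have h2 : ‖a‖ * ‖z‖ ≤ r * r := by gcongr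
        nlinarith
      have hdpos : 0 < R * (R - r) := mul_pos hR (by linarith)
      have hden0 : ∀ z : ℂ, ‖z‖ ≤ r → (R : ℂ) ^ 2 - (starRingEnd ℂ) a * z ≠ 0 := fun z hz ↦
        norm_pos_iff.1 (hdpos.trans_le (hden z hz))
      refine ⟨a ::ₘ Z, by simpa using hZc, ?_, ?_⟩
      · intro b hb
        rcases Multiset.mem_cons.1 hb with rfl | hb
        · exact ⟨hfa, har⟩
        · refine ⟨?_, (hZ b hb).2⟩
          have h := hfg b
          rw [(hZ b hb).1, mul_zero, mul_zero] at h
          exact (mul_eq_zero.1 h).resolve_right (hden0 b (hZ b hb).2)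
      · intro z hz hfz
        have hzr : ‖z‖ ≤ r := hz.trans hr'r.le
        have hD := hden0 z hzr
        have hza : z - a ≠ 0 := by
          intro h
          exact hfz (by rw [sub_eq_zero.1 h, hfa])
        have hRc : (R : ℂ) ≠ 0 := by exact_mod_cast hR.ne'
        have hgz : g z ≠ 0 := by
          intro h
          have h' := hfg z
          rw [h, mul_zero, mul_zero] at h'
          exact (mul_ne_zero hfz hD) h'
        have hld : logDeriv f z = logDeriv g z + (z - a)⁻¹
            + (starRingEnd ℂ) a / ((R : ℂ) ^ 2 - (starRingEnd ℂ) a * z) := by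
          have h1 : HasDerivAt (fun w ↦ f w * ((R : ℂ) ^ 2 - (starRingEnd ℂ) a * w))
              (deriv f z * ((R : ℂ) ^ 2 - (starRingEnd ℂ) a * z)
                + f z * (-(starRingEnd ℂ) a)) z := by
            have : HasDerivAt (fun w ↦ f w * ((R : ℂ) ^ 2 - (starRingEnd ℂ) a * w)) _ z :=
              (hf z).hasDerivAt.mul
                (((hasDerivAt_id z).const_mul ((starRingEnd ℂ) a)).const_sub ((R : ℂ) ^ 2))
            exact this.congr_deriv (by simp)
          have h2 : HasDerivAt (fun w ↦ (w - a) * (R * g w))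
              (1 * (R * g z) + (z - a) * (R * deriv g z)) z :=
            ((hasDerivAt_id z).sub_const a).mul ((hg z).hasDerivAt.const_mul (R : ℂ))
          have h3 : deriv f z * ((R : ℂ) ^ 2 - (starRingEnd ℂ) a * z)
              + f z * (-(starRingEnd ℂ) a) = 1 * (R * g z) + (z - a) * (R * deriv g z) := by
            rw [← h1.deriv, ← h2.deriv]
            congr 1
            funext w
            exact hfg w
          have h4 := hfg z
          rw [logDeriv_apply, logDeriv_apply]
          generalize (R : ℂ) ^ 2 - (starRingEnd ℂ) a * z = D at *
          generalize z - a = u at *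
          have hfz' : f z = u * (R * g z) / D := by field_simp; linear_combination h4
          have hdf : deriv f z = (R * g z + u * (R * deriv g z)
              + f z * (starRingEnd ℂ) a) / D := by
            field_simp; linear_combination h3
          rw [hdf, hfz']
          field_simp
          ring
        have hlast : ‖(starRingEnd ℂ) a / ((R : ℂ) ^ 2 - (starRingEnd ℂ) a * z)‖
            ≤ 1 / (R - r) := by
          rw [norm_div, RCLike.norm_conj]
          calc ‖a‖ / ‖(R : ℂ) ^ 2 - (starRingEnd ℂ) a * z‖ ≤ R / (R * (R - r)) := by
                gcongr
                · linarith
                · exact hden z hzr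
            _ = 1 / (R - r) := by field_simp
        have hlogle : Real.log (M / ‖g 0‖) ≤ Real.log (M / ‖f 0‖) := by
          have : 0 < M := by linarith
          have := norm_pos_iff.2 hg0
          gcongr
        rw [hld, Multiset.map_cons, Multiset.sum_cons]
        calc _ = ‖(logDeriv g z - (Z.map fun a ↦ (z - a)⁻¹).sum)
              + (starRingEnd ℂ) a / ((R : ℂ) ^ 2 - (starRingEnd ℂ) a * z)‖ := by
                congr 1; ring
          _ ≤ _ := norm_add_le _ _
          _ ≤ (8 * r / (r - r') ^ 2 * (Real.log (M / ‖g 0‖) + 1) + n * (1 / (R - r)))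
              + 1 / (R - r) := add_le_add (hbound z hz hgz) hlast
          _ ≤ (8 * r / (r - r') ^ 2 * (Real.log (M / ‖f 0‖) + 1) + n * (1 / (R - r)))
              + 1 / (R - r) := by gcongr
          _ = _ := by push_cast; ring
    · push Not at hz
      refine ⟨0, by simp, by simp, ?_⟩
      intro z hzr _
      have h := norm_logDeriv_le_of_ne_zero hr'.le hr'r hf
        (fun w hw ↦ hz w (by simpa using (Metric.mem_ball.1 hw).le))
        (fun w hw ↦ hmax f hf hM w (Metric.ball_subset_closedBall
          (Metric.ball_subset_ball hrR.le hw))) hzr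
      simp only [Multiset.map_zero, Multiset.sum_zero, sub_zero]
      have : (0 : ℝ) ≤ ((n + 1 : ℕ) : ℝ) * (1 / (R - r)) := by positivity
      linarith

open MeasureTheory

theorem mellin_fract_differentiableAt {s : ℂ} (hs : 0 < s.re) :
    DifferentiableAt ℂ (mellin (Set.indicator (Set.Ioi (1 : ℝ)) fun t ↦ ((Int.fract t : ℝ) : ℂ)))
      (-s) := by
  have hb : ∀ t : ℝ, ‖(Set.indicator (Set.Ioi (1 : ℝ)) fun t ↦ ((Int.fract t : ℝ) : ℂ)) t‖ ≤ 1 := by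
    intro t
    refine (norm_indicator_le_norm_self _ _).trans ?_
    rw [Complex.norm_real, Real.norm_eq_abs, Int.abs_fract]
    exact (Int.fract_lt_one t).le
  refine mellin_differentiableAt_of_isBigO_rpow (a := 0) (b := -s.re - 1) ?_ ?_ (by simpa using hs)
    ?_ (by simp)
  · have hm : Measurable (Set.indicator (Set.Ioi (1 : ℝ)) fun t ↦ ((Int.fract t : ℝ) : ℂ)) :=
      (Complex.measurable_ofReal.comp measurable_fract).indicator measurableSet_Ioi
    exact (MeasureTheory.LocallyIntegrable.locallyIntegrableOn
      ((locallyIntegrable_const (1 : ℝ)).mono hm.aestronglyMeasurable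
        (Eventually.of_forall fun t ↦ by simpa using hb t)) _)
  · refine Asymptotics.IsBigO.of_bound 1 (Eventually.of_forall fun t ↦ ?_)
    simpa using hb t
  · refine Asymptotics.IsBigO.of_bound 1 ?_
    filter_upwards [mem_nhdsWithin_of_mem_nhds (Iio_mem_nhds (zero_lt_one (α := ℝ)))] with t ht
    rw [Set.indicator_of_notMem (by simpa using (Set.mem_Iio.1 ht).le)]
    simp only [norm_zero]
    positivity

theorem mellin_fract_eq_integral (s : ℂ) :
    mellin (Set.indicator (Set.Ioi (1 : ℝ)) fun t ↦ ((Int.fract t : ℝ) : ℂ)) (-s)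
      = ∫ t in Set.Ioi (1 : ℝ), ((Int.fract t : ℝ) : ℂ) * (t : ℂ) ^ (-(s + 1)) := by
  rw [mellin, ← integral_indicator measurableSet_Ioi, ← integral_indicator measurableSet_Ioi]
  congr 1
  funext t
  by_cases ht : 1 < t
  · rw [Set.indicator_of_mem (Set.mem_Ioi.2 (zero_lt_one.trans ht)),
      Set.indicator_of_mem (Set.mem_Ioi.2 ht), Set.indicator_of_mem (Set.mem_Ioi.2 ht)]
    rw [smul_eq_mul, mul_comm]
    congr 2
    ring
  · rw [Set.indicator_of_notMem (s := Set.Ioi (1 : ℝ)) (by simpa using ht)]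
    by_cases h0 : 0 < t
    · rw [Set.indicator_of_mem (Set.mem_Ioi.2 h0), Set.indicator_of_notMem (by simpa using ht)]
      simp
    · rw [Set.indicator_of_notMem (by simpa using h0)]

theorem norm_mellin_fract_le {s : ℂ} (hs : 0 < s.re) :
    ‖mellin (Set.indicator (Set.Ioi (1 : ℝ)) fun t ↦ ((Int.fract t : ℝ) : ℂ)) (-s)‖ ≤ 1 / s.re := by
  rw [mellin_fract_eq_integral]
  have hInt : IntegrableOn (fun t : ℝ ↦ t ^ (-(s.re + 1))) (Set.Ioi 1) :=
    integrableOn_Ioi_rpow_of_lt (by linarith) zero_lt_one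
  refine (norm_integral_le_of_norm_le hInt ?_).trans (le_of_eq ?_)
  · filter_upwards [ae_restrict_mem measurableSet_Ioi] with t ht
    have ht0 : 0 < t := zero_lt_one.trans ht
    rw [norm_mul, Complex.norm_real, Real.norm_eq_abs, Int.abs_fract,
      Complex.norm_cpow_eq_rpow_re_of_pos ht0]
    have h1 := (Int.fract_lt_one t).le
    have h2 : 0 ≤ t ^ (-(s.re + 1)) := by positivity
    simp only [Complex.neg_re, Complex.add_re, Complex.one_re]
    nlinarith
  · rw [integral_Ioi_rpow_of_lt (by linarith) zero_lt_one, Real.one_rpow]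
    have : -(s.re + 1) + 1 = -s.re := by ring
    rw [this, neg_div_neg_eq]

theorem riemannZeta₁_eq_sub_mellin_fract {s : ℂ} (hs : 0 < s.re) :
    riemannZeta₁ s = s - s * (s - 1) *
      mellin (Set.indicator (Set.Ioi (1 : ℝ)) fun t ↦ ((Int.fract t : ℝ) : ℂ)) (-s) := by
  have hU : IsOpen {w : ℂ | 0 < w.re} := isOpen_lt continuous_const Complex.continuous_re
  have hL : AnalyticOnNhd ℂ riemannZeta₁ {w : ℂ | 0 < w.re} := fun w _ ↦
    differentiable_riemannZeta₁.analyticAt w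
  have hRt : AnalyticOnNhd ℂ (fun s : ℂ ↦ s - s * (s - 1) *
      mellin (Set.indicator (Set.Ioi (1 : ℝ)) fun t ↦ ((Int.fract t : ℝ) : ℂ)) (-s))
      {w : ℂ | 0 < w.re} := by
    refine DifferentiableOn.analyticOnNhd (fun w hw ↦ ?_) hU
    have h1 : DifferentiableAt ℂ (fun s : ℂ ↦
        mellin (Set.indicator (Set.Ioi (1 : ℝ)) fun t ↦ ((Int.fract t : ℝ) : ℂ)) (-s)) w :=
      DifferentiableAt.comp (g := mellin (Set.indicator (Set.Ioi (1 : ℝ))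
        fun t ↦ ((Int.fract t : ℝ) : ℂ))) (f := fun s : ℂ ↦ -s) w
        (mellin_fract_differentiableAt hw) (differentiableAt_id.neg)
    exact (differentiableAt_id.sub ((differentiableAt_id.mul
      (differentiableAt_id.sub_const 1)).mul h1)).differentiableWithinAt
  have hconv : Convex ℝ {w : ℂ | 0 < w.re} := convex_halfSpace_re_gt 0
  refine hL.eqOn_of_preconnected_of_eventuallyEq hRt hconv.isPreconnected
    (z₀ := 2) (by simp) ?_ hs
  have hnear : {w : ℂ | 1 < w.re} ∈ 𝓝 (2 : ℂ) :=
    (isOpen_lt continuous_const Complex.continuous_re).mem_nhds (by simp)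
  filter_upwards [hnear] with w hw
  have hw1 : 1 < w.re := hw
  have hne : w ≠ 1 := fun h ↦ by rw [h] at hw1; simp at hw1
  have hw0 : w - 1 ≠ 0 := sub_ne_zero.2 hne
  have hz1 : riemannZeta₁ w = (w - 1) * riemannZeta w := by
    rw [riemannZeta_eq_inv_sub_mul hne, mul_inv_cancel_left₀ hw0]
  have hzeta : riemannZeta w = w * ∫ t in Set.Ioi (1 : ℝ),
      (∑ k ∈ Finset.Icc 1 ⌊t⌋₊, (1 : ℕ → ℂ) k) * (t : ℂ) ^ (-(w + 1)) := by
    rw [← LSeries_one_eq_riemannZeta hw1]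
    refine LSeries_eq_mul_integral' 1 zero_le_one hw1 ?_
    refine Asymptotics.IsBigO.of_bound 1 (Eventually.of_forall fun n ↦ ?_)
    simp
  have hi1 : IntegrableOn (fun t : ℝ ↦ (t : ℂ) ^ (-w)) (Set.Ioi 1) :=
    integrableOn_Ioi_cpow_of_lt (by simpa using hw1) zero_lt_one
  have hi2 : IntegrableOn (fun t : ℝ ↦ ((Int.fract t : ℝ) : ℂ) * (t : ℂ) ^ (-(w + 1)))
      (Set.Ioi 1) := by
    have h := integrableOn_Ioi_cpow_of_lt (a := -(w + 1)) (c := 1) (by simp; linarith) zero_lt_one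
    refine Integrable.bdd_mul (c := 1) h
      (Complex.measurable_ofReal.comp measurable_fract).aestronglyMeasurable ?_
    refine Eventually.of_forall fun t ↦ ?_
    rw [Complex.norm_real, Real.norm_eq_abs, Int.abs_fract]
    exact (Int.fract_lt_one t).le
  have hsplit : ∫ t in Set.Ioi (1 : ℝ),
      (∑ k ∈ Finset.Icc 1 ⌊t⌋₊, (1 : ℕ → ℂ) k) * (t : ℂ) ^ (-(w + 1))
      = (∫ t in Set.Ioi (1 : ℝ), (t : ℂ) ^ (-w))
        - ∫ t in Set.Ioi (1 : ℝ), ((Int.fract t : ℝ) : ℂ) * (t : ℂ) ^ (-(w + 1)) := by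
    rw [← integral_sub hi1 hi2]
    refine setIntegral_congr_fun measurableSet_Ioi fun t ht ↦ ?_
    have ht0 : 0 < t := zero_lt_one.trans ht
    have htc : (t : ℂ) ≠ 0 := by exact_mod_cast ht0.ne'
    have h1 : (t : ℂ) ^ (-w) = t * (t : ℂ) ^ (-(w + 1)) := by
      rw [show -w = 1 + -(w + 1) by ring, Complex.cpow_add _ _ htc, Complex.cpow_one]
    have h2 : (⌊t⌋₊ : ℂ) = t - ((Int.fract t : ℝ) : ℂ) := by
      have h3 : (⌊t⌋₊ : ℝ) = t - Int.fract t := by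
        rw [natCast_floor_eq_intCast_floor ht0.le, Int.self_sub_fract]
      exact_mod_cast h3
    simp only [Pi.one_apply, Finset.sum_const, Nat.card_Icc, add_tsub_cancel_right, nsmul_eq_mul,
      mul_one]
    rw [h1, h2]
    ring
  rw [hz1, hzeta, hsplit, mellin_fract_eq_integral, integral_Ioi_cpow_of_lt (by simpa using hw1)
    zero_lt_one]
  have : -w + 1 ≠ 0 := by
    intro h; apply hw0; linear_combination -h
  rw [Complex.ofReal_one, Complex.one_cpow]
  field_simp
  ring

theorem norm_riemannZeta₁_le {s : ℂ} (hs : 1 / 8 ≤ s.re) :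
    ‖riemannZeta₁ s‖ ≤ 9 * (‖s‖ + 1) ^ 2 := by
  have hs0 : 0 < s.re := by linarith
  rw [riemannZeta₁_eq_sub_mellin_fract hs0]
  have h1 := norm_mellin_fract_le hs0
  have h2 : 1 / s.re ≤ 8 := by rw [div_le_iff₀ hs0]; linarith
  have h3 : ‖s - 1‖ ≤ ‖s‖ + 1 := by simpa using norm_sub_le s 1
  refine (norm_sub_le _ _).trans ?_
  rw [norm_mul, norm_mul]
  have h4 : ‖s‖ * ‖s - 1‖ * ‖mellin (Set.indicator (Set.Ioi (1 : ℝ))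
      fun t ↦ ((Int.fract t : ℝ) : ℂ)) (-s)‖ ≤ ‖s‖ * (‖s‖ + 1) * 8 := by
    gcongr
    exact h1.trans h2
  nlinarith [norm_nonneg s]

theorem riemannZeta₁_eq_mul {s : ℂ} (hs : s ≠ 1) : riemannZeta₁ s = (s - 1) * riemannZeta s := by
  rw [riemannZeta_eq_inv_sub_mul hs, mul_inv_cancel_left₀ (sub_ne_zero.2 hs)]

theorem le_norm_riemannZeta₁_of_re_eq_two {s : ℂ} (hs : s.re = 2) :
    3 / 10 ≤ ‖riemannZeta₁ s‖ := by
  have hne : s ≠ 1 := fun h ↦ by rw [h] at hs; norm_num at hs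
  have hs1 : 1 < s.re := by rw [hs]; norm_num
  rw [riemannZeta₁_eq_mul hne, norm_mul]
  have h1 : 1 ≤ ‖s - 1‖ := by
    have := Complex.abs_re_le_norm (s - 1)
    rw [Complex.sub_re, hs] at this
    norm_num at this
    exact this
  have hterm : ∀ n : ℕ, ‖1 / ((n : ℂ) + 1) ^ s‖ = 1 / ((n + 1 : ℕ) : ℝ) ^ 2 := by
    intro n
    have : ((n : ℂ) + 1) = ((n + 1 : ℕ) : ℂ) := by push_cast; ring
    rw [this, norm_div, norm_one, Complex.norm_natCast_cpow_of_pos n.succ_pos, hs]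
    norm_num
  have hsum2 : HasSum (fun n : ℕ ↦ 1 / ((n + 1 : ℕ) : ℝ) ^ 2) (Real.pi ^ 2 / 6) := by
    have := (hasSum_nat_add_iff' 1).2 hasSum_zeta_two
    simpa using this
  have hsum : Summable fun n : ℕ ↦ 1 / ((n : ℂ) + 1) ^ s := by
    refine Summable.of_norm ?_
    simp only [hterm]
    exact hsum2.summable
  have htail : ‖riemannZeta s - 1‖ ≤ Real.pi ^ 2 / 6 - 1 := by
    rw [zeta_eq_tsum_one_div_nat_add_one_cpow hs1, hsum.tsum_eq_zero_add]
    simp only [Nat.cast_zero, zero_add, Complex.one_cpow, div_one, add_sub_cancel_left]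
    have h2 := (hasSum_nat_add_iff' 1).2 hsum2
    simp only [Finset.range_one, Finset.sum_singleton, zero_add, Nat.cast_one, one_pow,
      div_one] at h2
    rw [← h2.tsum_eq]
    refine tsum_of_norm_bounded h2.summable.hasSum fun n ↦ ?_
    rw [hterm (n + 1)]
  have hpi : Real.pi ^ 2 / 6 - 1 ≤ 7 / 10 := by
    nlinarith [Real.pi_lt_d2, Real.pi_pos]
  have h3 : 3 / 10 ≤ ‖riemannZeta s‖ := by
    have h4 : ‖(1 : ℂ)‖ ≤ ‖riemannZeta s‖ + ‖riemannZeta s - 1‖ := by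
      have := norm_sub_le (riemannZeta s) (riemannZeta s - 1)
      simpa using this
    rw [norm_one] at h4
    linarith
  nlinarith

theorem re_eq_half_of_riemannZeta₁_eq_zero (RH : RiemannHypothesis) {s : ℂ} (hs : 0 < s.re)
    (h : riemannZeta₁ s = 0) : s.re = 1 / 2 := by
  have hne : s ≠ 1 := by
    rintro rfl
    simp at h
  refine RH s (by rw [riemannZeta_eq_inv_sub_mul hne, h, mul_zero]) ?_ hne
  rintro ⟨n, rfl⟩
  simp at hs
  linarith [(Nat.cast_nonneg n : (0 : ℝ) ≤ n)]

theorem riemannZeta₁_ne_zero_of_half_lt_re (RH : RiemannHypothesis) {s : ℂ} (hs : 1 / 2 < s.re) :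
    riemannZeta₁ s ≠ 0 := fun h ↦ by
  have := re_eq_half_of_riemannZeta₁_eq_zero RH (by linarith) h
  linarith

theorem riemannZeta₁_conj (s : ℂ) :
    riemannZeta₁ ((starRingEnd ℂ) s) = (starRingEnd ℂ) (riemannZeta₁ s) := by
  rcases eq_or_ne s 1 with rfl | hs
  · simp
  · have hs' : (starRingEnd ℂ) s ≠ 1 := fun h ↦ hs (by
      have := congrArg (starRingEnd ℂ) h
      simpa using this)
    rw [riemannZeta₁_eq_mul hs, riemannZeta₁_eq_mul hs', riemannZeta_conj]
    simp

theorem logDeriv_riemannZeta₁_conj (s : ℂ) :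
    logDeriv riemannZeta₁ ((starRingEnd ℂ) s) = (starRingEnd ℂ) (logDeriv riemannZeta₁ s) := by
  have h : deriv riemannZeta₁ ((starRingEnd ℂ) s) = (starRingEnd ℂ) (deriv riemannZeta₁ s) := by
    have h1 := (differentiable_riemannZeta₁ s).hasDerivAt.conj_conj
    have h2 : (starRingEnd ℂ) ∘ riemannZeta₁ ∘ (starRingEnd ℂ) = riemannZeta₁ := by
      funext w
      simp [riemannZeta₁_conj]
    rw [h2] at h1
    exact h1.deriv
  rw [logDeriv_apply, logDeriv_apply, h, riemannZeta₁_conj, map_div₀]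

theorem norm_riemannZeta₁_two_add_le (T : ℝ) {z : ℂ} (hz : ‖z‖ ≤ 15 / 8) :
    ‖riemannZeta₁ (2 + T * Complex.I + z)‖ ≤ 9 * (|T| + 5) ^ 2 := by
  have h1 := (abs_le.1 ((Complex.abs_re_le_norm z).trans hz)).1
  have h2 : ‖2 + T * Complex.I + z‖ ≤ |T| + 4 := by
    refine (norm_add₃_le).trans ?_
    rw [norm_mul, Complex.norm_real, Complex.norm_I, Real.norm_eq_abs, Complex.norm_ofNat]
    linarith
  refine (norm_riemannZeta₁_le ?_).trans ?_
  · simp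
    linarith
  · have : ‖2 + T * Complex.I + z‖ + 1 ≤ |T| + 5 := by linarith
    gcongr

theorem one_le_log_abs_add_five (T : ℝ) : 1 ≤ Real.log (|T| + 5) := by
  rw [Real.le_log_iff_exp_le (by positivity)]
  linarith [Real.exp_one_lt_d9, abs_nonneg T]

theorem log_bound_div_norm_riemannZeta₁_le (T : ℝ) :
    Real.log (9 * (|T| + 5) ^ 2 / ‖riemannZeta₁ (2 + T * Complex.I)‖)
      ≤ 5 * Real.log (|T| + 5) := by
  have h0 : 3 / 10 ≤ ‖riemannZeta₁ (2 + T * Complex.I)‖ :=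
    le_norm_riemannZeta₁_of_re_eq_two (by simp)
  have h5 : 5 ≤ |T| + 5 := by linarith [abs_nonneg T]
  have hpos : 0 < ‖riemannZeta₁ (2 + T * Complex.I)‖ := by linarith
  rw [← Nat.cast_ofNat (n := 5) (R := ℝ), ← Real.log_pow, Nat.cast_ofNat]
  refine Real.log_le_log (by positivity) ?_
  rw [div_le_iff₀ hpos]
  have h3 : 30 ≤ (|T| + 5) ^ 3 := by
    calc (30 : ℝ) ≤ 5 ^ 3 := by norm_num
      _ ≤ _ := by gcongr
  calc 9 * (|T| + 5) ^ 2 = (|T| + 5) ^ 2 * 30 * (3 / 10) := by ring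
    _ ≤ (|T| + 5) ^ 2 * (|T| + 5) ^ 3 * ‖riemannZeta₁ (2 + T * Complex.I)‖ := by gcongr
    _ = _ := by ring

theorem logDeriv_riemannZeta₁_const_add (c z : ℂ) :
    logDeriv (fun z ↦ riemannZeta₁ (c + z)) z = logDeriv riemannZeta₁ (c + z) := by
  rw [logDeriv_apply, logDeriv_apply, deriv_comp_const_add]

theorem norm_logDeriv_riemannZeta₁_le (RH : RiemannHypothesis) {σ₀ : ℝ} (hσ₀ : 1 / 2 < σ₀) {s : ℂ}
    (hs : σ₀ ≤ s.re) (hs2 : s.re ≤ 2) :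
    ‖logDeriv riemannZeta₁ s‖ ≤ 72 / (σ₀ - 1 / 2) ^ 2 * Real.log (|s.im| + 5) := by
  have hs' : s = 2 + s.im * Complex.I + ((s.re - 2 : ℝ) : ℂ) := by
    apply Complex.ext <;> simp
  have hmain := norm_logDeriv_le_of_ne_zero (g := fun z ↦ riemannZeta₁ (2 + s.im * Complex.I + z))
    (r := 2 - σ₀) (R := 3 / 2) (M := 9 * (|s.im| + 5) ^ 2) (by linarith) (by linarith)
    (differentiable_riemannZeta₁.comp ((differentiable_const _).add differentiable_id))
    (fun z hz ↦ by
      have := (abs_lt.1 ((Complex.abs_re_le_norm z).trans_lt (mem_ball_zero_iff.1 hz))).1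
      exact riemannZeta₁_ne_zero_of_half_lt_re RH (by simp; linarith))
    (fun z hz ↦ norm_riemannZeta₁_two_add_le _ (by
      have := mem_ball_zero_iff.1 hz
      linarith))
    (z := ((s.re - 2 : ℝ) : ℂ)) (by
      rw [Complex.norm_real, Real.norm_eq_abs, abs_of_nonpos (by linarith)]
      linarith)
  rw [logDeriv_riemannZeta₁_const_add, ← hs', add_zero] at hmain
  refine hmain.trans ?_
  have h1 := log_bound_div_norm_riemannZeta₁_le s.im
  have h2 := one_le_log_abs_add_five s.im
  have h3 : 0 < (3 / 2 - (2 - σ₀)) ^ 2 := by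
    apply pow_pos; linarith
  calc 8 * (3 / 2) / (3 / 2 - (2 - σ₀)) ^ 2 * (Real.log (9 * (|s.im| + 5) ^ 2 /
        ‖riemannZeta₁ (2 + s.im * Complex.I)‖) + 1)
      ≤ 8 * (3 / 2) / (3 / 2 - (2 - σ₀)) ^ 2 * (6 * Real.log (|s.im| + 5)) := by
        gcongr
        linarith
    _ = 72 / (σ₀ - 1 / 2) ^ 2 * Real.log (|s.im| + 5) := by
        rw [show 3 / 2 - (2 - σ₀) = σ₀ - 1 / 2 by ring]
        ring

theorem exists_zeros_logDeriv_riemannZeta₁_sub_sum_le (RH : RiemannHypothesis) (T : ℝ) :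
    ∃ Z : Multiset ℂ, (Multiset.card Z : ℝ) ≤ 76 * Real.log (|T| + 5) ∧
      (∀ a ∈ Z, a.re = 1 / 2) ∧
      ∀ s : ℂ, 1 / 2 < s.re → s.re ≤ 2 → |s.im - T| ≤ 1 / 2 →
        ‖logDeriv riemannZeta₁ s - (Z.map fun a ↦ (s - a)⁻¹).sum‖
          ≤ 6000 * Real.log (|T| + 5) := by
  set c : ℂ := 2 + T * Complex.I with hc
  set M : ℝ := 9 * (|T| + 5) ^ 2 with hM
  have hf0 : 0 < ‖riemannZeta₁ c‖ := by
    have := le_norm_riemannZeta₁_of_re_eq_two (s := c) (by simp [hc])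
    linarith
  have hlog := log_bound_div_norm_riemannZeta₁_le T
  have hone := one_le_log_abs_add_five T
  rw [← hc, ← hM] at hlog
  have hMpos : 0 < M := by positivity
  set n : ℕ := ⌊Real.log (M / ‖riemannZeta₁ c‖) / Real.log (15 / 14)⌋₊ + 1 with hn
  have hl15 : 1 / 15 ≤ Real.log (15 / 14) := by
    have := Real.one_sub_inv_le_log_of_pos (x := 15 / 14) (by norm_num)
    norm_num at this ⊢
    linarith
  have hl0 : 0 < Real.log (15 / 14) := by linarith
  have hnl : (n : ℝ) ≤ 76 * Real.log (|T| + 5) := by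
    rw [hn]
    push_cast
    have h1 : (⌊Real.log (M / ‖riemannZeta₁ c‖) / Real.log (15 / 14)⌋₊ : ℝ)
        ≤ 75 * Real.log (|T| + 5) := by
      refine (Nat.cast_le.2 (Nat.floor_mono (b := 75 * Real.log (|T| + 5)) ?_)).trans
        (Nat.floor_le (by linarith))
      rw [div_le_iff₀ hl0]
      nlinarith
    linarith
  have hlt : M < ‖riemannZeta₁ (c + 0)‖ * ((15 / 8) / (7 / 4)) ^ n := by
    rw [add_zero, ← div_lt_iff₀' hf0, ← Real.log_lt_log_iff (by positivity) (by positivity),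
      Real.log_pow, show ((15 : ℝ) / 8) / (7 / 4) = 15 / 14 by norm_num, ← div_lt_iff₀ hl0, hn]
    push_cast
    exact Nat.lt_floor_add_one _
  obtain ⟨Z, hcard, hzero, hsum⟩ := exists_zeros_logDeriv_sub_sum_le (r' := 13 / 8) (r := 7 / 4)
    (R := 15 / 8) (M := M) (by norm_num) (by norm_num) (by norm_num) n
    (fun z ↦ riemannZeta₁ (c + z))
    (differentiable_riemannZeta₁.comp ((differentiable_const _).add differentiable_id))
    (by simpa using hf0) (fun z hz ↦ norm_riemannZeta₁_two_add_le T
      (mem_sphere_zero_iff_norm.1 hz).le) hlt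
  refine ⟨Z.map (c + ·), ?_, ?_, ?_⟩
  · rw [Multiset.card_map]
    exact (Nat.cast_le.2 hcard).trans hnl
  · intro a ha
    obtain ⟨b, hb, rfl⟩ := Multiset.mem_map.1 ha
    obtain ⟨hb0, hbn⟩ := hzero b hb
    refine re_eq_half_of_riemannZeta₁_eq_zero RH ?_ hb0
    have := (abs_le.1 ((Complex.abs_re_le_norm b).trans hbn)).1
    simp [hc]
    linarith
  · intro s hs1 hs2 hsT
    have hz : ‖s - c‖ ≤ 13 / 8 := by
      refine abs_le_of_sq_le_sq' ?_ (by norm_num) |>.2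
      rw [Complex.sq_norm, Complex.normSq_apply]
      have h1 : (s - c).re = s.re - 2 := by simp [hc]
      have h2 : (s - c).im = s.im - T := by simp [hc]
      rw [h1, h2]
      obtain ⟨h3, h4⟩ := abs_le.1 hsT
      nlinarith
    have hmain := hsum (s - c) hz (by
      simpa using riemannZeta₁_ne_zero_of_half_lt_re RH hs1)
    rw [logDeriv_riemannZeta₁_const_add, add_sub_cancel] at hmain
    have hmap : ((Z.map (c + ·)).map fun a ↦ (s - a)⁻¹).sum
        = (Z.map fun a ↦ (s - c - a)⁻¹).sum := by
      rw [Multiset.map_map]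
      congr 2
      funext a
      simp [sub_sub]
    rw [hmap]
    refine hmain.trans ?_
    rw [add_zero]
    norm_num
    linarith

theorem integral_div_sq_add_sq_le_pi {d : ℝ} (hd : 0 < d) (γ a b : ℝ) :
    ∫ t in a..b, d / (d ^ 2 + (t - γ) ^ 2) ≤ Real.pi := by
  have hcont : Continuous fun t : ℝ ↦ d / (d ^ 2 + (t - γ) ^ 2) := by
    refine continuous_const.div (by fun_prop) fun t ↦ ?_
    positivity
  have hder : ∀ t ∈ Set.uIcc a b, HasDerivAt (fun t ↦ Real.arctan ((t - γ) / d))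
      (d / (d ^ 2 + (t - γ) ^ 2)) t := by
    intro t _
    have h := (((hasDerivAt_id t).sub_const γ).div_const d).arctan
    refine h.congr_deriv ?_
    simp only [id]
    field_simp
  rw [intervalIntegral.integral_eq_sub_of_hasDerivAt hder (hcont.intervalIntegrable _ _)]
  linarith [Real.arctan_lt_pi_div_two ((b - γ) / d), Real.neg_pi_div_two_lt_arctan ((a - γ) / d)]

theorem re_inv_sub_eq {σ : ℝ} {a : ℂ} (ha : a.re = 1 / 2) (t : ℝ) :
    ((σ + t * Complex.I - a)⁻¹).re = (σ - 1 / 2) / ((σ - 1 / 2) ^ 2 + (t - a.im) ^ 2) := by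
  rw [Complex.inv_re, Complex.normSq_apply]
  simp [ha]
  ring

theorem re_sum_inv_sub_bounds {σ : ℝ} (hσ : 1 / 2 < σ) (Z : Multiset ℂ)
    (hZ : ∀ a ∈ Z, a.re = 1 / 2) (u v : ℝ) :
    (∀ t : ℝ, 0 ≤ ((Z.map fun a ↦ (σ + t * Complex.I - a)⁻¹).sum).re) ∧
    (Continuous fun t : ℝ ↦ ((Z.map fun a ↦ (σ + t * Complex.I - a)⁻¹).sum).re) ∧
    ∫ t in u..v, ((Z.map fun a ↦ (σ + t * Complex.I - a)⁻¹).sum).re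
      ≤ Multiset.card Z * Real.pi := by
  have hd : 0 < σ - 1 / 2 := by linarith
  induction Z using Multiset.induction_on with
  | empty => simp [continuous_const]
  | cons a Z ih =>
    obtain ⟨h1, h2, h3⟩ := ih fun b hb ↦ hZ b (Multiset.mem_cons_of_mem hb)
    have ha := hZ a (Multiset.mem_cons_self a Z)
    have hcont : Continuous fun t : ℝ ↦ (σ - 1 / 2) / ((σ - 1 / 2) ^ 2 + (t - a.im) ^ 2) := by
      refine continuous_const.div (by fun_prop) fun t ↦ ?_
      positivity
    simp only [Multiset.map_cons, Multiset.sum_cons, Complex.add_re, re_inv_sub_eq ha,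
      Multiset.card_cons]
    refine ⟨fun t ↦ add_nonneg (by positivity) (h1 t), hcont.add h2, ?_⟩
    rw [intervalIntegral.integral_add (hcont.intervalIntegrable _ _) (h2.intervalIntegrable _ _)]
    have := integral_div_sq_add_sq_le_pi hd a.im u v
    push_cast
    linarith

theorem continuous_logDeriv_riemannZeta₁_vertical (RH : RiemannHypothesis) {σ : ℝ}
    (hσ : 1 / 2 < σ) : Continuous fun t : ℝ ↦ logDeriv riemannZeta₁ (σ + t * Complex.I) := by
  simp only [logDeriv_apply]
  have hd : Continuous (deriv riemannZeta₁) :=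
    differentiable_riemannZeta₁.contDiff.continuous_deriv_one
  refine (hd.comp (by fun_prop)).div (differentiable_riemannZeta₁.continuous.comp (by fun_prop))
    fun t ↦ riemannZeta₁_ne_zero_of_half_lt_re RH (by simpa using hσ)

theorem integral_abs_re_logDeriv_riemannZeta₁_le (RH : RiemannHypothesis) {σ : ℝ}
    (hσ : 1 / 2 < σ) (hσ2 : σ ≤ 2) (T : ℝ) :
    ∫ t in (T - 1 / 2)..(T + 1 / 2), |(logDeriv riemannZeta₁ (σ + t * Complex.I)).re|
      ≤ 6400 * Real.log (|T| + 5) := by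
  obtain ⟨Z, hcard, hZ, hbound⟩ := exists_zeros_logDeriv_riemannZeta₁_sub_sum_le RH T
  obtain ⟨h1, h2, h3⟩ := re_sum_inv_sub_bounds hσ Z hZ (T - 1 / 2) (T + 1 / 2)
  have hone := one_le_log_abs_add_five T
  have hle : ∀ t ∈ Set.Icc (T - 1 / 2) (T + 1 / 2),
      |(logDeriv riemannZeta₁ (σ + t * Complex.I)).re| ≤ 6000 * Real.log (|T| + 5) +
        ((Z.map fun a ↦ (σ + t * Complex.I - a)⁻¹).sum).re := by
    intro t ht
    have hb := hbound (σ + t * Complex.I) (by simpa using hσ) (by simpa using hσ2) (by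
      rw [abs_le]
      simp
      constructor <;> linarith [ht.1, ht.2])
    have hre := (Complex.abs_re_le_norm _).trans hb
    rw [Complex.sub_re, abs_le] at hre
    have := h1 t
    rw [abs_le]
    constructor <;> linarith [hre.1, hre.2]
  have hcl := (Complex.continuous_re.comp
    (continuous_logDeriv_riemannZeta₁_vertical RH hσ)).abs
  refine (intervalIntegral.integral_mono_on (by linarith) (hcl.intervalIntegrable _ _)
    ((continuous_const.fun_add h2).intervalIntegrable _ _) hle).trans ?_
  rw [intervalIntegral.integral_add (continuous_const.intervalIntegrable _ _)
    (h2.intervalIntegrable _ _), intervalIntegral.integral_const, smul_eq_mul]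
  have hpi : (Multiset.card Z : ℝ) * Real.pi ≤ 76 * Real.log (|T| + 5) * 4 := by
    gcongr
    exact Real.pi_le_four
  linarith

theorem integrable_of_norm_le_one_add_abs_rpow {f : ℝ → ℂ} (hf : Continuous f) {B p : ℝ}
    (hp : 1 < p) (hb : ∀ t, ‖f t‖ ≤ B * (1 + |t|) ^ (-p)) : Integrable f := by
  have h : Integrable fun t : ℝ ↦ (1 + ‖t‖) ^ (-p) := integrable_one_add_norm (by simpa using hp)
  refine (h.const_mul B).mono' hf.aestronglyMeasurable (Eventually.of_forall fun t ↦ ?_)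
  simpa using hb t

theorem integral_vertical_eq_of_norm_le {Φ : ℂ → ℂ} {σ c B p : ℝ} (hσc : σ ≤ c) (hp : 1 < p)
    (hΦ : ∀ s : ℂ, σ ≤ s.re → s.re ≤ c → DifferentiableAt ℂ Φ s)
    (hb : ∀ s : ℂ, σ ≤ s.re → s.re ≤ c → ‖Φ s‖ ≤ B * (1 + |s.im|) ^ (-p)) :
    ∫ t : ℝ, Φ (σ + t * Complex.I) = ∫ t : ℝ, Φ (c + t * Complex.I) := by
  have hline : ∀ x : ℝ, σ ≤ x → x ≤ c → Integrable fun t : ℝ ↦ Φ (x + t * Complex.I) := by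
    intro x hx1 hx2
    refine integrable_of_norm_le_one_add_abs_rpow (B := B) ?_ hp fun t ↦ ?_
    · refine continuous_iff_continuousAt.2 fun t ↦ ?_
      refine ContinuousAt.comp (g := Φ) (hΦ _ (by simpa using hx1) (by simpa using hx2)).continuousAt
        (by fun_prop)
    · simpa using hb (x + t * Complex.I) (by simpa using hx1) (by simpa using hx2)
  have hlim : ∀ x : ℝ, σ ≤ x → x ≤ c → Tendsto (fun T : ℝ ↦ ∫ t in (-T)..T, Φ (x + t * Complex.I))
      atTop (𝓝 (∫ t : ℝ, Φ (x + t * Complex.I))) := fun x hx1 hx2 ↦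
    intervalIntegral_tendsto_integral (hline x hx1 hx2) tendsto_neg_atTop_atBot tendsto_id
  have hdecay : Tendsto (fun T : ℝ ↦ B * (1 + |T|) ^ (-p) * |c - σ|) atTop (𝓝 0) := by
    have h1 : Tendsto (fun T : ℝ ↦ (1 + |T|) ^ (-p)) atTop (𝓝 0) :=
      (tendsto_rpow_neg_atTop (by linarith)).comp
        (tendsto_atTop_add_const_left _ _ tendsto_abs_atTop_atTop)
    simpa using (h1.const_mul B).mul_const |c - σ|
  have hhor : ∀ T y : ℝ, |y| = |T| →
      ‖∫ x in σ..c, Φ (x + y * Complex.I)‖ ≤ B * (1 + |T|) ^ (-p) * |c - σ| := by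
    intro T y hy
    refine intervalIntegral.norm_integral_le_of_norm_le_const fun x hx ↦ ?_
    rw [Set.uIoc_of_le hσc] at hx
    have := hb (x + y * Complex.I) (by simpa using hx.1.le) (by simpa using hx.2)
    simpa [hy] using this
  have hrect : ∀ T : ℝ, (∫ t in (-T)..T, Φ (c + t * Complex.I))
      - (∫ t in (-T)..T, Φ (σ + t * Complex.I))
      = Complex.I * ((∫ x in σ..c, Φ (x + (-T : ℝ) * Complex.I))
        - ∫ x in σ..c, Φ (x + (T : ℝ) * Complex.I)) := by
    intro T
    have h := Complex.integral_boundary_rect_eq_zero_of_differentiableOn Φ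
      (σ + (-T : ℝ) * Complex.I) (c + T * Complex.I) (by
        intro s hs
        rw [Complex.mem_reProdIm] at hs
        have h1 := hs.1
        simp only [Complex.add_re, Complex.ofReal_re, Complex.mul_re, Complex.I_re, mul_zero,
          Complex.ofReal_im, Complex.I_im, mul_one, sub_self, add_zero, Set.uIcc_of_le hσc] at h1
        exact (hΦ s h1.1 h1.2).differentiableWithinAt)
    simp only [Complex.add_re, Complex.ofReal_re, Complex.mul_re, Complex.I_re, mul_zero,
      Complex.ofReal_im, Complex.I_im, mul_one, sub_self, add_zero, Complex.add_im, Complex.mul_im,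
      zero_add, smul_eq_mul] at h
    linear_combination (-Complex.I) * h + ((∫ t in (-T)..T, Φ (c + t * Complex.I))
      - (∫ t in (-T)..T, Φ (σ + t * Complex.I))) * Complex.I_mul_I
  have hzero : Tendsto (fun T : ℝ ↦ (∫ t in (-T)..T, Φ (c + t * Complex.I))
      - (∫ t in (-T)..T, Φ (σ + t * Complex.I))) atTop (𝓝 0) := by
    refine squeeze_zero_norm (a := fun T ↦ 2 * (B * (1 + |T|) ^ (-p) * |c - σ|)) (fun T ↦ ?_)
      (by simpa using hdecay.const_mul 2)
    rw [hrect, norm_mul, Complex.norm_I, one_mul]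
    refine (norm_sub_le _ _).trans ?_
    have h1 := hhor T (-T) (abs_neg T)
    have h2 := hhor T T rfl
    linarith
  have := tendsto_nhds_unique hzero ((hlim c hσc le_rfl).sub (hlim σ le_rfl hσc))
  exact (sub_eq_zero.1 this.symm).symm

theorem mul_one_add_abs_im_le_norm {d : ℝ} {s : ℂ} (hd0 : 0 ≤ d) (hd1 : d ≤ 1) (h : d ≤ s.re) :
    d / 2 * (1 + |s.im|) ≤ ‖s‖ := by
  have h1 := (le_abs_self _).trans (Complex.abs_re_le_norm s)
  have h2 := Complex.abs_im_le_norm s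
  nlinarith [abs_nonneg s.im]

theorem norm_inv_mul_add_one_le {d : ℝ} {s : ℂ} (hd0 : 0 < d) (hd1 : d ≤ 1) (h : d ≤ s.re) :
    ‖(s * (s + 1))⁻¹‖ ≤ 4 / d ^ 2 * (1 + |s.im|) ^ (-(2 : ℝ)) := by
  have h1 := mul_one_add_abs_im_le_norm hd0.le hd1 h
  have h2 := mul_one_add_abs_im_le_norm (s := s + 1) hd0.le hd1 (by simp; linarith)
  simp only [Complex.add_im, Complex.one_im, add_zero] at h2
  have hpos : 0 < 1 + |s.im| := by positivity
  rw [norm_inv, norm_mul, Real.rpow_neg hpos.le, Real.rpow_two]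
  calc (‖s‖ * ‖s + 1‖)⁻¹ ≤ (d / 2 * (1 + |s.im|) * (d / 2 * (1 + |s.im|)))⁻¹ := by gcongr
    _ = _ := by field_simp; norm_num

theorem log_abs_add_five_le (t : ℝ) :
    Real.log (|t| + 5) ≤ 6 * (1 + |t|) ^ (1 / 2 : ℝ) := by
  have h0 := abs_nonneg t
  have h1 := Real.log_le_rpow_div (x := |t| + 5) (ε := 1 / 2) (by positivity) (by norm_num)
  have h2 : (|t| + 5) ^ (1 / 2 : ℝ) ≤ (9 * (1 + |t|)) ^ (1 / 2 : ℝ) := by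
    gcongr
    linarith
  rw [Real.mul_rpow (by norm_num) (by positivity), show (9 : ℝ) = 3 ^ (2 : ℝ) by norm_num,
    ← Real.rpow_mul (by norm_num)] at h2
  norm_num at h2 h1 ⊢
  linarith

theorem hasMellin_max_one_sub {s : ℂ} (hs : 0 < s.re) :
    HasMellin (fun u : ℝ ↦ ((max (1 - u) 0 : ℝ) : ℂ)) s (s * (s + 1))⁻¹ := by
  have h1 := hasMellin_one_Ioc hs
  have h2 := hasMellin_cpow_Ioc 1 (s := s) (by simp; linarith)
  have h3 := hasMellin_sub h1.1 h2.1
  have hcongr : Set.EqOn (fun u : ℝ ↦ (u : ℂ) ^ (s - 1) • (Set.indicator (Set.Ioc 0 1)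
      (fun _ ↦ 1 : ℝ → ℂ) u - Set.indicator (Set.Ioc 0 1) (fun t ↦ ↑t ^ (1 : ℂ) : ℝ → ℂ) u))
      (fun u : ℝ ↦ (u : ℂ) ^ (s - 1) • ((max (1 - u) 0 : ℝ) : ℂ)) (Set.Ioi 0) := by
    intro u hu
    have hu0 : 0 < u := hu
    dsimp only
    congr 1
    by_cases h : u ≤ 1
    · have hmem : u ∈ Set.Ioc (0 : ℝ) 1 := ⟨hu0, h⟩
      rw [Set.indicator_of_mem hmem, Set.indicator_of_mem hmem, Complex.cpow_one,
        max_eq_left (by linarith)]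
      push_cast
      ring
    · rw [Set.indicator_of_notMem (fun h' ↦ h h'.2), Set.indicator_of_notMem (fun h' ↦ h h'.2),
        max_eq_right (by linarith)]
      simp
  have hs0 : s ≠ 0 := fun h ↦ by rw [h] at hs; simp at hs
  have hs1 : s + 1 ≠ 0 := fun h ↦ by
    have := congrArg Complex.re h
    simp at this
    linarith
  refine ⟨h3.1.congr_fun hcongr measurableSet_Ioi, ?_⟩
  have h4 := h3.2
  rw [h1.2, h2.2] at h4
  rw [mellin, ← setIntegral_congr_fun measurableSet_Ioi hcongr]
  refine h4.trans ?_
  field_simp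
  ring

theorem continuous_inv_mul_add_one_vertical {c : ℝ} (hc : 0 < c) :
    Continuous fun t : ℝ ↦ ((c + t * Complex.I) * (c + t * Complex.I + 1))⁻¹ := by
  refine Continuous.inv₀ (by fun_prop) fun t ↦ ?_
  refine mul_ne_zero (fun h ↦ ?_) (fun h ↦ ?_) <;>
  · have := congrArg Complex.re h
    simp at this
    linarith

theorem integrable_inv_mul_add_one_vertical {c : ℝ} (hc : 0 < c) :
    Integrable fun t : ℝ ↦ ((c + t * Complex.I) * (c + t * Complex.I + 1))⁻¹ := by
  refine integrable_of_norm_le_one_add_abs_rpow (B := 4 / (min c 1) ^ 2) (p := 2)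
    (continuous_inv_mul_add_one_vertical hc) (by norm_num) fun t ↦ ?_
  have := norm_inv_mul_add_one_le (s := c + t * Complex.I) (lt_min hc one_pos) (min_le_right _ _)
    (by simp)
  simpa using this

theorem integral_cpow_mul_inv_mul_add_one {c u : ℝ} (hc : 0 < c) (hu : 0 < u) :
    ∫ t : ℝ, (u : ℂ) ^ (-(c + t * Complex.I)) * ((c + t * Complex.I) * (c + t * Complex.I + 1))⁻¹
      = 2 * Real.pi * ((max (1 - u) 0 : ℝ) : ℂ) := by
  have hre : ∀ t : ℝ, 0 < (c + t * Complex.I : ℂ).re := fun t ↦ by simpa using hc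
  have h := mellinInv_mellin_eq c (fun u : ℝ ↦ ((max (1 - u) 0 : ℝ) : ℂ)) hu
    (hasMellin_max_one_sub (by simpa using hc)).1 (by
      unfold Complex.VerticalIntegrable
      simp only [(hasMellin_max_one_sub (hre _)).2]
      exact integrable_inv_mul_add_one_vertical hc) (by fun_prop)
  rw [mellinInv] at h
  simp only [(hasMellin_max_one_sub (hre _)).2, smul_eq_mul] at h
  have : (Real.pi : ℂ) ≠ 0 := by exact_mod_cast Real.pi_ne_zero
  rw [← h, Complex.real_smul, ← mul_assoc]
  push_cast
  rw [mul_one_div_cancel (mul_ne_zero two_ne_zero this), one_mul]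

theorem neg_logDeriv_riemannZeta₁_eq {s : ℂ} (hs : 1 < s.re) :
    -logDeriv riemannZeta₁ s
      = LSeries (fun n ↦ (ArithmeticFunction.vonMangoldt n : ℂ)) s - 1 / (s - 1) := by
  have hne : s ≠ 1 := fun h ↦ by rw [h] at hs; simp at hs
  have h0 : s - 1 ≠ 0 := sub_ne_zero.2 hne
  rw [ArithmeticFunction.LSeries_vonMangoldt_eq_deriv_riemannZeta_div hs,
    deriv_riemannZeta_eq_neg_inv_sub_sq_mul_add hne, riemannZeta_eq_inv_sub_mul hne, logDeriv_apply]
  have h1 : riemannZeta₁ s ≠ 0 := by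
    rw [riemannZeta₁_eq_mul hne]
    exact mul_ne_zero h0 (riemannZeta_ne_zero_of_one_le_re hs.le)
  field_simp
  ring

theorem integral_mul_neg_logDeriv_riemannZeta₁ {H : ℝ → ℂ} (hH : Integrable H) {c : ℝ}
    (hc : 1 < c) :
    ∫ t : ℝ, H t * -logDeriv riemannZeta₁ (c + t * Complex.I)
      = ∑' n : ℕ, (ArithmeticFunction.vonMangoldt n : ℂ) *
          (∫ t : ℝ, H t * (n : ℂ) ^ (-(c + t * Complex.I)))
        - ∫ y in Set.Ioi (1 : ℝ), ∫ t : ℝ, H t * (y : ℂ) ^ (-(c + t * Complex.I)) := by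
  have hre : ∀ t : ℝ, (c + t * Complex.I : ℂ).re = c := fun t ↦ by simp
  have hre1 : ∀ t : ℝ, 1 < (c + t * Complex.I : ℂ).re := fun t ↦ by simpa using hc
  have hne : ∀ t : ℝ, (c + t * Complex.I : ℂ) ≠ 0 := fun t h ↦ by
    have := hre1 t
    rw [h] at this
    norm_num at this
  have hterm : ∀ (n : ℕ) (t : ℝ), H t * LSeries.term
      (fun n ↦ (ArithmeticFunction.vonMangoldt n : ℂ)) (c + t * Complex.I) n
      = (ArithmeticFunction.vonMangoldt n : ℂ) * (H t * (n : ℂ) ^ (-(c + t * Complex.I))) := by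
    intro n t
    rw [LSeries.term_of_ne_zero' (hne t), Complex.cpow_neg]
    ring
  have hnormterm : ∀ (n : ℕ) (t : ℝ), ‖LSeries.term
      (fun n ↦ (ArithmeticFunction.vonMangoldt n : ℂ)) (c + t * Complex.I) n‖
      = ‖LSeries.term (fun n ↦ (ArithmeticFunction.vonMangoldt n : ℂ)) c n‖ := by
    intro n t
    rw [LSeries.norm_term_eq, LSeries.norm_term_eq, hre, Complex.ofReal_re]
  have hcontterm : ∀ n : ℕ, Continuous fun t : ℝ ↦ LSeries.term
      (fun n ↦ (ArithmeticFunction.vonMangoldt n : ℂ)) (c + t * Complex.I) n := by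
    intro n
    rcases eq_or_ne n 0 with rfl | hn
    · simp [continuous_const]
    · have hnc : (n : ℂ) ≠ 0 := by exact_mod_cast hn
      simp only [LSeries.term_of_ne_zero hn]
      refine continuous_const.div ?_ fun t ↦ ?_
      · exact Continuous.const_cpow (by fun_prop) (Or.inl hnc)
      · simp [Complex.cpow_eq_zero_iff, hnc]
  have hInt : ∀ n : ℕ, Integrable fun t : ℝ ↦ H t * LSeries.term
      (fun n ↦ (ArithmeticFunction.vonMangoldt n : ℂ)) (c + t * Complex.I) n := fun n ↦
    hH.mul_bdd (c := ‖LSeries.term (fun n ↦ (ArithmeticFunction.vonMangoldt n : ℂ)) c n‖)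
      (hcontterm n).aestronglyMeasurable (Eventually.of_forall fun t ↦ (hnormterm n t).le)
  have hsummable : Summable fun n : ℕ ↦ ∫ t : ℝ, ‖H t * LSeries.term
      (fun n ↦ (ArithmeticFunction.vonMangoldt n : ℂ)) (c + t * Complex.I) n‖ := by
    simp only [norm_mul, hnormterm, integral_mul_const]
    exact ((ArithmeticFunction.LSeriesSummable_vonMangoldt (s := c) (by simpa using hc)).norm).mul_left
      _
  have hsum := hasSum_integral_of_summable_integral_norm hInt hsummable
  have hD : (∑' n : ℕ, (ArithmeticFunction.vonMangoldt n : ℂ) *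
      (∫ t : ℝ, H t * (n : ℂ) ^ (-(c + t * Complex.I))))
      = ∫ t : ℝ, H t * LSeries (fun n ↦ (ArithmeticFunction.vonMangoldt n : ℂ))
          (c + t * Complex.I) := by
    refine Eq.trans ?_ (hsum.tsum_eq.trans ?_)
    · congr 1
      funext n
      rw [← integral_const_mul]
      simp only [hterm]
    · congr 1
      funext t
      rw [tsum_mul_left, LSeries]
  have hswap : Integrable (Function.uncurry fun (t y : ℝ) ↦ H t * (y : ℂ) ^ (-(c + t * Complex.I)))
      (volume.prod (volume.restrict (Set.Ioi 1))) := by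
    have hb : Integrable (fun z : ℝ × ℝ ↦ ‖H z.1‖ * z.2 ^ (-c))
        (volume.prod (volume.restrict (Set.Ioi 1))) :=
      hH.norm.mul_prod (integrableOn_Ioi_rpow_of_lt (by linarith) zero_lt_one)
    refine hb.mono' ?_ ?_
    · refine hH.aestronglyMeasurable.comp_fst.mul ?_
      refine Measurable.aestronglyMeasurable ?_
      fun_prop
    · have : ∀ᵐ z : ℝ × ℝ ∂(volume.prod (volume.restrict (Set.Ioi 1))), z.2 ∈ Set.Ioi (1 : ℝ) :=
        Measure.quasiMeasurePreserving_snd.ae (ae_restrict_mem measurableSet_Ioi)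
      filter_upwards [this] with z hz
      have hz0 : 0 < z.2 := zero_lt_one.trans hz
      rw [Function.uncurry, norm_mul, Complex.norm_cpow_eq_rpow_re_of_pos hz0, Complex.neg_re, hre]
  have hfub := integral_integral_swap hswap
  have hI : (∫ y in Set.Ioi (1 : ℝ), ∫ t : ℝ, H t * (y : ℂ) ^ (-(c + t * Complex.I)))
      = ∫ t : ℝ, H t * (1 / (c + t * Complex.I - 1)) := by
    rw [← hfub]
    congr 1
    funext t
    rw [integral_const_mul, integral_Ioi_cpow_of_lt (by simpa using hc) zero_lt_one,
      Complex.ofReal_one, Complex.one_cpow, ← neg_div_neg_eq]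
    congr 2
    · ring
    · ring
  rw [hD, hI, ← integral_sub]
  · congr 1
    funext t
    rw [neg_logDeriv_riemannZeta₁_eq (hre1 t)]
    ring
  · have := hsum.summable
    refine (hH.mul_bdd (c := ∑' n, ‖LSeries.term
      (fun n ↦ (ArithmeticFunction.vonMangoldt n : ℂ)) c n‖) ?_ ?_)
    · refine (continuous_tsum hcontterm (u := fun n ↦ ‖LSeries.term
        (fun n ↦ (ArithmeticFunction.vonMangoldt n : ℂ)) c n‖)
        (ArithmeticFunction.LSeriesSummable_vonMangoldt (s := c) (by simpa using hc)).norm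
        fun n t ↦ (hnormterm n t).le).aestronglyMeasurable
    · refine Eventually.of_forall fun t ↦ tsum_of_norm_bounded
        (ArithmeticFunction.LSeriesSummable_vonMangoldt (s := c) (by simpa using hc)).norm.hasSum
        fun n ↦ (hnormterm n t).le
  · refine hH.mul_bdd (c := 1 / (c - 1)) ?_ ?_
    · refine Continuous.aestronglyMeasurable ?_
      refine continuous_const.div (by fun_prop) fun t h ↦ ?_
      have := congrArg Complex.re h
      simp at this
      linarith
    · refine Eventually.of_forall fun t ↦ ?_
      rw [norm_div, norm_one]
      have := (le_abs_self _).trans (Complex.abs_re_le_norm (c + t * Complex.I - 1))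
      simp only [Complex.sub_re, hre, Complex.one_re] at this
      have : 0 < c - 1 := by linarith
      gcongr

theorem integral_Ioi_max_one_sub_div {a : ℝ} (ha : 1 ≤ a) :
    ∫ y in Set.Ioi (1 : ℝ), max (1 - y / a) 0 = (a - 1) ^ 2 / (2 * a) := by
  have ha0 : 0 < a := by linarith
  rw [setIntegral_eq_of_subset_of_forall_sdiff_eq_zero measurableSet_Ioi
    (show Set.Ioc 1 a ⊆ Set.Ioi 1 from Set.Ioc_subset_Ioi_self)]
  · rw [setIntegral_congr_fun (g := fun y ↦ 1 - y / a) measurableSet_Ioc,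
      ← intervalIntegral.integral_of_le ha]
    · rw [intervalIntegral.integral_sub 
        (f := fun _ ↦ (1 : ℝ)) (g := fun x ↦ x / a) (by simp)
        (Continuous.intervalIntegrable (by fun_prop) _ _),
        intervalIntegral.integral_div, integral_id]
      simp
      field_simp
      ring
    · intro y hy
      refine max_eq_left ?_
      rw [sub_nonneg, div_le_one ha0]
      exact hy.2
  · intro y hy
    refine max_eq_right ?_
    have hy1 : 1 < y := hy.1
    have : a < y := not_le.1 fun h ↦ hy.2 ⟨hy1, h⟩
    rw [sub_nonpos, one_le_div ha0]
    exact this.le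

theorem continuous_cpow_vertical {a : ℝ} (ha : 0 < a) (c : ℂ) :
    Continuous fun t : ℝ ↦ (a : ℂ) ^ (c + t * Complex.I) :=
  Continuous.const_cpow (by fun_prop) (Or.inl (by exact_mod_cast ha.ne'))

theorem integrable_cpow_mul_inv_mul_add_one {a c : ℝ} (ha : 0 < a) (hc : 0 < c) :
    Integrable fun t : ℝ ↦ (a : ℂ) ^ (c + t * Complex.I) *
      ((c + t * Complex.I) * (c + t * Complex.I + 1))⁻¹ := by
  refine (integrable_inv_mul_add_one_vertical hc).bdd_mul (c := a ^ c)
    (continuous_cpow_vertical ha c).aestronglyMeasurable (Eventually.of_forall fun t ↦ ?_)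
  rw [Complex.norm_cpow_eq_rpow_re_of_pos ha]
  simp

theorem integral_cpow_mul_neg_logDeriv_riemannZeta₁ {a c : ℝ} (ha : 1 ≤ a) (hc : 1 < c) {N : ℕ}
    (hN : a ≤ N + 1) :
    ∫ t : ℝ, (a : ℂ) ^ (c + t * Complex.I) * ((c + t * Complex.I) * (c + t * Complex.I + 1))⁻¹ *
        -logDeriv riemannZeta₁ (c + t * Complex.I)
      = 2 * Real.pi * ((∑ n ∈ Finset.Ioc 0 N, ArithmeticFunction.vonMangoldt n *
          max (1 - n / a) 0 - (a - 1) ^ 2 / (2 * a) : ℝ) : ℂ) := by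
  have ha0 : 0 < a := by linarith
  have hac : (a : ℂ) ≠ 0 := by exact_mod_cast ha0.ne'
  have hĤ : ∀ y : ℝ, 0 < y → ∫ t : ℝ, (a : ℂ) ^ (c + t * Complex.I) *
      ((c + t * Complex.I) * (c + t * Complex.I + 1))⁻¹ * (y : ℂ) ^ (-(c + t * Complex.I))
      = 2 * Real.pi * ((max (1 - y / a) 0 : ℝ) : ℂ) := by
    intro y hy
    rw [← integral_cpow_mul_inv_mul_add_one (c := c) (by linarith) (div_pos hy ha0)]
    congr 1
    funext t
    have h1 : (y : ℂ) ^ (-(c + t * Complex.I))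
        = ((y / a : ℝ) : ℂ) ^ (-(c + t * Complex.I)) * (a : ℂ) ^ (-(c + t * Complex.I)) := by
      rw [← Complex.mul_cpow_ofReal_nonneg (by positivity) ha0.le, ← Complex.ofReal_mul,
        div_mul_cancel₀ _ ha0.ne']
    have h2 : (a : ℂ) ^ (c + t * Complex.I) * (a : ℂ) ^ (-(c + t * Complex.I)) = 1 := by
      rw [← Complex.cpow_add _ _ hac, add_neg_cancel, Complex.cpow_zero]
    rw [h1]
    linear_combination (((c + t * Complex.I) * (c + t * Complex.I + 1))⁻¹ *
      ((y / a : ℝ) : ℂ) ^ (-(c + t * Complex.I))) * h2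
  rw [integral_mul_neg_logDeriv_riemannZeta₁ (integrable_cpow_mul_inv_mul_add_one ha0
    (by linarith)) hc, setIntegral_congr_fun (g := fun y : ℝ ↦
    2 * Real.pi * ((max (1 - y / a) 0 : ℝ) : ℂ)) measurableSet_Ioi
    (fun y hy ↦ hĤ y (zero_lt_one.trans hy)), integral_const_mul, integral_complex_ofReal,
    integral_Ioi_max_one_sub_div ha]
  have hterm : ∀ n : ℕ, (ArithmeticFunction.vonMangoldt n : ℂ) *
      (∫ t : ℝ, (a : ℂ) ^ (c + t * Complex.I) * ((c + t * Complex.I) * (c + t * Complex.I + 1))⁻¹ *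
        (n : ℂ) ^ (-(c + t * Complex.I)))
      = 2 * Real.pi * ((ArithmeticFunction.vonMangoldt n * max (1 - n / a) 0 : ℝ) : ℂ) := by
    intro n
    rcases eq_or_ne n 0 with rfl | hn
    · simp
    · have := hĤ n (by exact_mod_cast Nat.pos_of_ne_zero hn)
      rw [Complex.ofReal_natCast] at this
      rw [this]
      push_cast
      ring
  simp only [hterm]
  rw [tsum_eq_sum (s := Finset.Ioc 0 N), ← Finset.mul_sum]
  · push_cast
    ring
  · intro n hn
    rw [Finset.mem_Ioc, not_and_or, not_lt, not_le, Nat.le_zero] at hn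
    rcases hn with rfl | hn
    · simp
    · have h1 : (N : ℝ) + 1 ≤ n := by exact_mod_cast hn
      rw [max_eq_right]
      · simp
      · rw [sub_nonpos, one_le_div ha0]
        linarith

theorem integral_reflected_cpow_mul_neg_logDeriv_riemannZeta₁ {a c σ : ℝ} (ha : 1 ≤ a)
    (hc : 1 < c) (hcσ : c < 2 * σ) :
    ∫ t : ℝ, (a : ℂ) ^ (2 * σ - (c + t * Complex.I)) *
        ((2 * σ - (c + t * Complex.I)) * (2 * σ - (c + t * Complex.I) + 1))⁻¹ *
        -logDeriv riemannZeta₁ (c + t * Complex.I)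
      = 2 * Real.pi * (-logDeriv riemannZeta₁ (2 * σ)
          - -logDeriv riemannZeta₁ (2 * σ + 1) / a) := by
  have ha0 : 0 < a := by linarith
  have hac : (a : ℂ) ≠ 0 := by exact_mod_cast ha0.ne'
  have hd : 0 < 2 * σ - c := by linarith
  have hneg : ∀ t : ℝ, (2 * σ - (c + t * Complex.I) : ℂ)
      = ((2 * σ - c : ℝ) : ℂ) + ((-t : ℝ) : ℂ) * Complex.I := by
    intro t
    push_cast
    ring
  have hH : Integrable fun t : ℝ ↦ (a : ℂ) ^ (2 * σ - (c + t * Complex.I)) *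
        ((2 * σ - (c + t * Complex.I)) * (2 * σ - (c + t * Complex.I) + 1))⁻¹ := by
    simp only [hneg]
    exact (integrable_cpow_mul_inv_mul_add_one ha0 hd).comp_neg
  have hĤ : ∀ y : ℝ, 1 ≤ y → ∫ t : ℝ, (a : ℂ) ^ (2 * σ - (c + t * Complex.I)) *
        ((2 * σ - (c + t * Complex.I)) * (2 * σ - (c + t * Complex.I) + 1))⁻¹ *
        (y : ℂ) ^ (-(c + t * Complex.I))
      = 2 * Real.pi * ((y : ℂ) ^ (-(2 * σ) : ℂ) - (y : ℂ) ^ (-(2 * σ + 1) : ℂ) / a) := by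
    intro y hy
    have hy0 : 0 < y := by linarith
    have hyc : (y : ℂ) ≠ 0 := by exact_mod_cast hy0.ne'
    have hay : 0 < a * y := by positivity
    have h := integral_cpow_mul_inv_mul_add_one hd (inv_pos.2 hay)
    rw [max_eq_left (by
      rw [sub_nonneg]
      exact inv_le_one_of_one_le₀ (one_le_mul_of_one_le_of_one_le ha hy))] at h
    rw [← integral_neg_eq_self] at h
    have h1 : ∀ t : ℝ, (a : ℂ) ^ (2 * σ - (c + t * Complex.I)) *
        ((2 * σ - (c + t * Complex.I)) * (2 * σ - (c + t * Complex.I) + 1))⁻¹ *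
        (y : ℂ) ^ (-(c + t * Complex.I)) = (y : ℂ) ^ (-(2 * σ) : ℂ) *
        ((((a * y)⁻¹ : ℝ) : ℂ) ^ (-(((2 * σ - c : ℝ) : ℂ) + ((-t : ℝ) : ℂ) * Complex.I)) *
        ((((2 * σ - c : ℝ) : ℂ) + ((-t : ℝ) : ℂ) * Complex.I) *
          (((2 * σ - c : ℝ) : ℂ) + ((-t : ℝ) : ℂ) * Complex.I + 1))⁻¹) := by
      intro t
      rw [hneg]
      set w : ℂ := ((2 * σ - c : ℝ) : ℂ) + ((-t : ℝ) : ℂ) * Complex.I with hw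
      have e1 : (((a * y)⁻¹ : ℝ) : ℂ) ^ (-w) = (a : ℂ) ^ w * (y : ℂ) ^ w := by
        rw [← Complex.mul_cpow_ofReal_nonneg ha0.le hy0.le, ← Complex.ofReal_mul,
          Complex.ofReal_inv, Complex.inv_cpow, Complex.cpow_neg, inv_inv]
        rw [Complex.arg_ofReal_of_nonneg hay.le]
        exact Real.pi_ne_zero.symm
      have e2 : (y : ℂ) ^ (-(c + t * Complex.I)) = (y : ℂ) ^ (-(2 * σ) : ℂ) * (y : ℂ) ^ w := by
        rw [← Complex.cpow_add _ _ hyc]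
        congr 1
        rw [hw]
        push_cast
        ring
      rw [e1, e2]
      ring
    simp only [h1]
    rw [integral_const_mul, h, neg_add, Complex.cpow_add _ _ hyc, Complex.cpow_neg_one]
    push_cast
    field_simp
  have hsum : HasSum (fun n : ℕ ↦ (ArithmeticFunction.vonMangoldt n : ℂ) *
      ∫ t : ℝ, (a : ℂ) ^ (2 * σ - (c + t * Complex.I)) *
        ((2 * σ - (c + t * Complex.I)) * (2 * σ - (c + t * Complex.I) + 1))⁻¹ *
        (n : ℂ) ^ (-(c + t * Complex.I)))
      (2 * Real.pi * (LSeries (fun n ↦ (ArithmeticFunction.vonMangoldt n : ℂ)) (2 * σ)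
        - LSeries (fun n ↦ (ArithmeticFunction.vonMangoldt n : ℂ)) (2 * σ + 1) / a)) := by
    have s1 : HasSum _ (LSeries (fun n ↦ (ArithmeticFunction.vonMangoldt n : ℂ)) (2 * σ)) :=
      (ArithmeticFunction.LSeriesSummable_vonMangoldt (s := 2 * σ) (by simp; linarith)).LSeriesHasSum
    have s2 : HasSum _ (LSeries (fun n ↦ (ArithmeticFunction.vonMangoldt n : ℂ)) (2 * σ + 1)) :=
      (ArithmeticFunction.LSeriesSummable_vonMangoldt (s := 2 * σ + 1)
        (by simp; linarith)).LSeriesHasSum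
    refine ((s1.sub (s2.div_const (a : ℂ))).mul_left (2 * Real.pi : ℂ)).congr_fun ?_
    intro n
    rcases eq_or_ne n 0 with rfl | hn
    · simp
    · have := hĤ n (by exact_mod_cast Nat.pos_of_ne_zero hn)
      rw [Complex.ofReal_natCast] at this
      rw [this, LSeries.term_of_ne_zero hn, LSeries.term_of_ne_zero hn, Complex.cpow_neg,
        Complex.cpow_neg]
      ring
  rw [integral_mul_neg_logDeriv_riemannZeta₁ hH hc, hsum.tsum_eq,
    setIntegral_congr_fun measurableSet_Ioi (fun y hy ↦ hĤ y (le_of_lt hy)), integral_const_mul,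
    integral_sub, integral_div, integral_Ioi_cpow_of_lt (by simp; linarith) zero_lt_one,
    integral_Ioi_cpow_of_lt (by simp; linarith) zero_lt_one,
    neg_logDeriv_riemannZeta₁_eq (by simp; linarith),
    neg_logDeriv_riemannZeta₁_eq (by simp; linarith)]
  · rw [Complex.ofReal_one, Complex.one_cpow, Complex.one_cpow,
      show -(2 * σ : ℂ) + 1 = -(2 * σ - 1) by ring, show -(2 * σ + 1 : ℂ) + 1 = -(2 * σ + 1 - 1) by ring,
      neg_div_neg_eq, neg_div_neg_eq]
    ring
  · exact integrableOn_Ioi_cpow_of_lt (by simp; linarith) zero_lt_one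
  · exact (integrableOn_Ioi_cpow_of_lt (by simp; linarith) zero_lt_one).div_const _

theorem integral_mul_neg_logDeriv_riemannZeta₁_shift (RH : RiemannHypothesis) {σ c B : ℝ}
    (hσ : 1 / 2 < σ) (hσc : σ ≤ c) (hc : c ≤ 2) {F : ℂ → ℂ}
    (hF : ∀ s : ℂ, σ ≤ s.re → s.re ≤ c → DifferentiableAt ℂ F s)
    (hb : ∀ s : ℂ, σ ≤ s.re → s.re ≤ c → ‖F s‖ ≤ B * (1 + |s.im|) ^ (-(2 : ℝ))) :
    (∫ t : ℝ, F (σ + t * Complex.I) * -logDeriv riemannZeta₁ (σ + t * Complex.I)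
      = ∫ t : ℝ, F (c + t * Complex.I) * -logDeriv riemannZeta₁ (c + t * Complex.I)) ∧
    Integrable fun t : ℝ ↦ F (σ + t * Complex.I) * -logDeriv riemannZeta₁ (σ + t * Complex.I) := by
  have hdiff : ∀ s : ℂ, σ ≤ s.re → s.re ≤ c →
      DifferentiableAt ℂ (fun s ↦ F s * -logDeriv riemannZeta₁ s) s := by
    intro s h1 h2
    refine (hF s h1 h2).mul (DifferentiableAt.neg ?_)
    have hd : DifferentiableAt ℂ (deriv riemannZeta₁) s :=
      differentiable_riemannZeta₁.contDiff.differentiable_deriv_two s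
    exact hd.div (differentiable_riemannZeta₁ s)
      (riemannZeta₁_ne_zero_of_half_lt_re RH (by linarith))
  have hbound : ∀ s : ℂ, σ ≤ s.re → s.re ≤ c → ‖F s * -logDeriv riemannZeta₁ s‖
      ≤ B * (72 / (σ - 1 / 2) ^ 2 * 6) * (1 + |s.im|) ^ (-(3 / 2 : ℝ)) := by
    intro s h1 h2
    have e1 := hb s h1 h2
    have e2 := (norm_logDeriv_riemannZeta₁_le RH hσ h1 (h2.trans hc)).trans
      (mul_le_mul_of_nonneg_left (log_abs_add_five_le s.im) (by positivity))
    have hpos : 0 < 1 + |s.im| := by positivity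
    rw [norm_mul, norm_neg]
    calc ‖F s‖ * ‖logDeriv riemannZeta₁ s‖
        ≤ (B * (1 + |s.im|) ^ (-(2 : ℝ))) *
          (72 / (σ - 1 / 2) ^ 2 * (6 * (1 + |s.im|) ^ (1 / 2 : ℝ))) := by
          gcongr
          exact (norm_nonneg _).trans e1
      _ = B * (72 / (σ - 1 / 2) ^ 2 * 6) *
          ((1 + |s.im|) ^ (-(2 : ℝ)) * (1 + |s.im|) ^ (1 / 2 : ℝ)) := by ring
      _ = _ := by
          rw [← Real.rpow_add hpos]
          norm_num
  refine ⟨integral_vertical_eq_of_norm_le hσc (by norm_num : (1 : ℝ) < 3 / 2) hdiff hbound, ?_⟩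
  refine integrable_of_norm_le_one_add_abs_rpow (B := B * (72 / (σ - 1 / 2) ^ 2 * 6))
    (p := 3 / 2) ?_ (by norm_num) fun t ↦ ?_
  · refine continuous_iff_continuousAt.2 fun t ↦ ?_
    exact ContinuousAt.comp (g := fun s ↦ F s * -logDeriv riemannZeta₁ s)
      (hdiff _ (by simp) (by simpa using hσc)).continuousAt (by fun_prop)
  · simpa using hbound (σ + t * Complex.I) (by simp) (by simpa using hσc)

theorem differentiableAt_cpow_mul_inv_mul_add_one {a : ℝ} (ha : 0 < a) {s : ℂ} (hs : 0 < s.re) :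
    DifferentiableAt ℂ (fun s ↦ (a : ℂ) ^ s * (s * (s + 1))⁻¹) s := by
  have hac : (a : ℂ) ≠ 0 := by exact_mod_cast ha.ne'
  refine (differentiableAt_id.const_cpow (Or.inl hac)).mul (DifferentiableAt.inv (by fun_prop) ?_)
  refine mul_ne_zero (fun h ↦ ?_) (fun h ↦ ?_)
  · simp [h] at hs
  · have := congrArg Complex.re h
    simp at this
    linarith

theorem norm_cpow_mul_inv_mul_add_one_le {a d : ℝ} (ha : 1 ≤ a) (hd : 0 < d) (hd1 : d ≤ 1) {s : ℂ}
    (hs : d ≤ s.re) (hs2 : s.re ≤ 2) :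
    ‖(a : ℂ) ^ s * (s * (s + 1))⁻¹‖ ≤ a ^ (2 : ℝ) * (4 / d ^ 2) * (1 + |s.im|) ^ (-(2 : ℝ)) := by
  rw [norm_mul, Complex.norm_cpow_eq_rpow_re_of_pos (by linarith), mul_assoc]
  have := norm_inv_mul_add_one_le hd hd1 hs
  have : a ^ s.re ≤ a ^ (2 : ℝ) := Real.rpow_le_rpow_of_exponent_le ha hs2
  gcongr

theorem integral_cpow_mul_re_neg_logDeriv_riemannZeta₁ (RH : RiemannHypothesis) {a σ : ℝ}
    (ha : 1 ≤ a) (hσ : 1 / 2 < σ) (hσ1 : σ ≤ 1) {N : ℕ} (hN : a ≤ N + 1) :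
    (Integrable fun t : ℝ ↦ (a : ℂ) ^ (σ + t * Complex.I + 1) *
        ((σ + t * Complex.I) * (σ + t * Complex.I + 1))⁻¹ *
        ((-logDeriv riemannZeta₁ (σ + t * Complex.I)).re : ℂ)) ∧
    ∫ t : ℝ, (a : ℂ) ^ (σ + t * Complex.I + 1) *
        ((σ + t * Complex.I) * (σ + t * Complex.I + 1))⁻¹ *
        ((-logDeriv riemannZeta₁ (σ + t * Complex.I)).re : ℂ)
      = Real.pi * (((∑ n ∈ Finset.Ioc 0 N, ArithmeticFunction.vonMangoldt n *
          max (a - n) 0 - (a - 1) ^ 2 / 2 : ℝ) : ℂ) + a * -logDeriv riemannZeta₁ (2 * σ)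
          - -logDeriv riemannZeta₁ (2 * σ + 1)) := by
  have ha0 : 0 < a := by linarith
  have hac : (a : ℂ) ≠ 0 := by exact_mod_cast ha0.ne'
  set c : ℝ := (1 + 2 * σ) / 2 with hc
  have hc1 : 1 < c := by rw [hc]; linarith
  have hcσ : c < 2 * σ := by rw [hc]; linarith
  have hσc : σ ≤ c := by linarith
  have hc2 : c ≤ 2 := by linarith
  obtain ⟨e1, i1⟩ := integral_mul_neg_logDeriv_riemannZeta₁_shift RH hσ hσc hc2
    (F := fun s ↦ (a : ℂ) ^ s * (s * (s + 1))⁻¹)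
    (fun s h1 _ ↦ differentiableAt_cpow_mul_inv_mul_add_one ha0 (by linarith))
    (fun s h1 h2 ↦ norm_cpow_mul_inv_mul_add_one_le ha (d := σ) (by linarith) hσ1 h1 (by linarith))
  obtain ⟨e2, i2⟩ := integral_mul_neg_logDeriv_riemannZeta₁_shift RH hσ hσc hc2
    (F := fun s ↦ (a : ℂ) ^ (2 * σ - s) * ((2 * σ - s) * (2 * σ - s + 1))⁻¹)
    (fun s h1 h2 ↦ DifferentiableAt.comp (g := fun s : ℂ ↦ (a : ℂ) ^ s * (s * (s + 1))⁻¹)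
      (f := fun s : ℂ ↦ 2 * σ - s) s (differentiableAt_cpow_mul_inv_mul_add_one ha0
        (by simp; linarith)) (by fun_prop))
    (B := a ^ (2 : ℝ) * (4 / (2 * σ - c) ^ 2))
    (fun s h1 h2 ↦ by
      have := norm_cpow_mul_inv_mul_add_one_le ha (d := 2 * σ - c) (s := 2 * σ - s) (by linarith)
        (by linarith) (by simp; linarith) (by simp; linarith)
      simpa using this)
  rw [integral_cpow_mul_neg_logDeriv_riemannZeta₁ ha hc1 hN] at e1
  rw [integral_reflected_cpow_mul_neg_logDeriv_riemannZeta₁ ha hc1 hcσ, ← integral_neg_eq_self] at e2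
  have hpt : ∀ t : ℝ, (a : ℂ) ^ (σ + t * Complex.I + 1) *
        ((σ + t * Complex.I) * (σ + t * Complex.I + 1))⁻¹ *
        ((-logDeriv riemannZeta₁ (σ + t * Complex.I)).re : ℂ)
      = (a / 2) * ((a : ℂ) ^ (σ + t * Complex.I) *
        ((σ + t * Complex.I) * (σ + t * Complex.I + 1))⁻¹ *
          -logDeriv riemannZeta₁ (σ + t * Complex.I) +
        (a : ℂ) ^ (2 * σ - (σ + ((-t : ℝ) : ℂ) * Complex.I)) *
          ((2 * σ - (σ + ((-t : ℝ) : ℂ) * Complex.I)) *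
            (2 * σ - (σ + ((-t : ℝ) : ℂ) * Complex.I) + 1))⁻¹ *
          -logDeriv riemannZeta₁ (σ + ((-t : ℝ) : ℂ) * Complex.I)) := by
    intro t
    have h1 : (2 * σ - (σ + ((-t : ℝ) : ℂ) * Complex.I) : ℂ) = σ + t * Complex.I := by
      push_cast
      ring
    have h2 : (σ + ((-t : ℝ) : ℂ) * Complex.I : ℂ) = (starRingEnd ℂ) (σ + t * Complex.I) := by
      simp
    rw [h1, h2, logDeriv_riemannZeta₁_conj, Complex.cpow_add _ _ hac, Complex.cpow_one,
      ← map_neg, Complex.re_eq_add_conj]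
    ring
  simp only [hpt]
  refine ⟨(i1.add i2.comp_neg).const_mul _, ?_⟩
  rw [integral_const_mul, integral_add i1 i2.comp_neg]
  rw [e1, e2]
  have hmax : ∑ n ∈ Finset.Ioc 0 N, ArithmeticFunction.vonMangoldt n * max (a - n) 0
      = a * ∑ n ∈ Finset.Ioc 0 N, ArithmeticFunction.vonMangoldt n * max (1 - n / a) 0 := by
    rw [Finset.mul_sum]
    refine Finset.sum_congr rfl fun n _ ↦ ?_
    rw [mul_left_comm, mul_max_of_nonneg _ _ ha0.le, mul_sub, mul_one, mul_zero,
      mul_div_cancel₀ _ ha0.ne']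
  rw [hmax]
  push_cast
  field_simp
  ring

theorem rpow_neg_one_sub_le_sub {x η : ℝ} (hx : 0 < x) (hη : 0 < η) :
    (x + 1) ^ (-1 - η) ≤ 1 / η * (x ^ (-η) - (x + 1) ^ (-η)) := by
  have hx1 : 0 < x + 1 := by linarith
  have h1 : 1 / (x + 1) ≤ Real.log ((x + 1) / x) := by
    refine le_trans (le_of_eq ?_) (Real.one_sub_inv_le_log_of_pos (by positivity))
    field_simp
    ring
  have h2 : 1 + η * (1 / (x + 1)) ≤ ((x + 1) / x) ^ η := by
    rw [Real.rpow_def_of_pos (by positivity)]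
    refine le_trans ?_ (Real.add_one_le_exp _)
    nlinarith
  have h3 : x ^ (-η) = (x + 1) ^ (-η) * ((x + 1) / x) ^ η := by
    rw [Real.div_rpow hx1.le hx.le, Real.rpow_neg hx.le, Real.rpow_neg hx1.le]
    have := (Real.rpow_pos_of_pos hx1 η).ne'
    field_simp
  have h4 : (x + 1) ^ (-1 - η) = (x + 1) ^ (-η) * (1 / (x + 1)) := by
    rw [show -1 - η = -η + -1 by ring, Real.rpow_add hx1, Real.rpow_neg_one, one_div]
  have h5 : 0 < (x + 1) ^ (-η) := Real.rpow_pos_of_pos hx1 _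
  rw [h3, h4, div_mul_eq_mul_div, one_mul, le_div_iff₀ hη]
  nlinarith

theorem sum_rpow_neg_one_sub_le {η : ℝ} (hη : 0 < η) (M : ℕ) :
    ∑ k ∈ Finset.range (M + 1), ((k : ℝ) + 1) ^ (-1 - η) ≤ 1 + 1 / η := by
  suffices h : ∑ k ∈ Finset.range (M + 1), ((k : ℝ) + 1) ^ (-1 - η)
      ≤ 1 + 1 / η - 1 / η * ((M : ℝ) + 1) ^ (-η) by
    have : 0 ≤ 1 / η * ((M : ℝ) + 1) ^ (-η) := by positivity
    linarith
  induction M with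
  | zero => simp
  | succ M ih =>
    rw [Finset.sum_range_succ]
    have := rpow_neg_one_sub_le_sub (x := (M : ℝ) + 1) (by positivity) hη
    push_cast
    linarith

theorem integral_weight_unit_interval_le {f : ℝ → ℝ} (hf : Continuous f) (hf0 : ∀ t, 0 ≤ f t)
    {A θ : ℝ} (hA : 0 ≤ A) (hθ : 0 < θ) (hθ1 : θ ≤ 1) (T : ℝ)
    (hbound : ∫ t in (T - 1 / 2)..(T + 1 / 2), f t ≤ A * Real.log (|T| + 5)) :
    ∫ t in (T - 1 / 2)..(T + 1 / 2), (1 + |t|) ^ (-1 - θ) * f t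
      ≤ 40 * A / θ * (|T| + 1) ^ (-1 - θ / 2) := by
  have hT := abs_nonneg T
  have hT1 : 0 < |T| + 1 := by positivity
  have hw : ∀ t ∈ Set.Icc (T - 1 / 2) (T + 1 / 2),
      (1 + |t|) ^ (-1 - θ) * f t ≤ 4 * (|T| + 1) ^ (-1 - θ) * f t := by
    intro t ht
    refine mul_le_mul_of_nonneg_right ?_ (hf0 t)
    have h1 : (1 / 2) * (|T| + 1) ≤ 1 + |t| := by
      have : |T| ≤ |t| + 1 / 2 := by
        have h2 : |T - t| ≤ 1 / 2 := by
          rw [abs_le]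
          constructor <;> linarith [ht.1, ht.2]
        have := abs_sub_abs_le_abs_sub T t
        linarith
      linarith
    have h2 : (1 + |t|) ^ (-1 - θ) ≤ ((1 / 2) * (|T| + 1)) ^ (-1 - θ) :=
      Real.rpow_le_rpow_of_nonpos (by positivity) h1 (by linarith)
    refine h2.trans ?_
    rw [Real.mul_rpow (by norm_num) hT1.le]
    gcongr
    rw [one_div, Real.inv_rpow (by norm_num), ← Real.rpow_neg (by norm_num)]
    calc (2 : ℝ) ^ (-(-1 - θ)) ≤ 2 ^ (2 : ℝ) :=
          Real.rpow_le_rpow_of_exponent_le (by norm_num) (by linarith)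
      _ = 4 := by norm_num
  have hcw : Continuous fun t : ℝ ↦ (1 + |t|) ^ (-1 - θ) * f t := by
    refine Continuous.mul (Continuous.rpow_const (by fun_prop) fun t ↦ Or.inl ?_) hf
    positivity
  refine (intervalIntegral.integral_mono_on (by linarith) (hcw.intervalIntegrable _ _)
    ((hf.const_mul _).intervalIntegrable _ _) hw).trans ?_
  rw [intervalIntegral.integral_const_mul]
  have hlog : Real.log (|T| + 5) ≤ 10 / θ * (|T| + 1) ^ (θ / 2) := by
    have h1 := Real.log_le_rpow_div (x := |T| + 5) (ε := θ / 2) (by positivity) (by positivity)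
    have h2 : (|T| + 5) ^ (θ / 2) ≤ (5 * (|T| + 1)) ^ (θ / 2) := by
      gcongr
      linarith
    rw [Real.mul_rpow (by norm_num) hT1.le] at h2
    have h3 : (5 : ℝ) ^ (θ / 2) ≤ 5 := by
      calc (5 : ℝ) ^ (θ / 2) ≤ 5 ^ (1 : ℝ) :=
            Real.rpow_le_rpow_of_exponent_le (by norm_num) (by linarith)
        _ = 5 := by norm_num
    calc Real.log (|T| + 5) ≤ (|T| + 5) ^ (θ / 2) / (θ / 2) := h1
      _ ≤ 5 * (|T| + 1) ^ (θ / 2) / (θ / 2) := by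
          gcongr
          exact h2.trans (by gcongr)
      _ = _ := by field_simp; ring
  calc 4 * (|T| + 1) ^ (-1 - θ) * ∫ t in (T - 1 / 2)..(T + 1 / 2), f t
      ≤ 4 * (|T| + 1) ^ (-1 - θ) * (A * (10 / θ * (|T| + 1) ^ (θ / 2))) := by
        gcongr
        exact hbound.trans (by gcongr)
    _ = 40 * A / θ * ((|T| + 1) ^ (-1 - θ) * (|T| + 1) ^ (θ / 2)) := by ring
    _ = _ := by
        rw [← Real.rpow_add hT1]
        congr 2
        ring

theorem integral_weight_le {f : ℝ → ℝ} (hf : Continuous f) (hf0 : ∀ t, 0 ≤ f t)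
    {A θ : ℝ} (hA : 0 ≤ A) (hθ : 0 < θ) (hθ1 : θ ≤ 1)
    (hbound : ∀ T, ∫ t in (T - 1 / 2)..(T + 1 / 2), f t ≤ A * Real.log (|T| + 5)) (M : ℕ) :
    ∫ t in (-((M : ℝ) + 1 / 2))..((M : ℝ) + 1 / 2), (1 + |t|) ^ (-1 - θ) * f t
      ≤ 240 * A / θ ^ 2 := by
  have hcw : Continuous fun t : ℝ ↦ (1 + |t|) ^ (-1 - θ) * f t := by
    refine Continuous.mul (Continuous.rpow_const (by fun_prop) fun t ↦ Or.inl ?_) hf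
    positivity
  have hInt : ∀ a b : ℝ, IntervalIntegrable (fun t : ℝ ↦ (1 + |t|) ^ (-1 - θ) * f t) volume a b :=
    fun a b ↦ hcw.intervalIntegrable a b
  have hunit := fun T ↦ integral_weight_unit_interval_le hf hf0 hA hθ hθ1 T (hbound T)
  have hsum : ∫ t in (-((M : ℝ) + 1 / 2))..((M : ℝ) + 1 / 2), (1 + |t|) ^ (-1 - θ) * f t
      ≤ ∑ k ∈ Finset.range (M + 1), 2 * (40 * A / θ * ((k : ℝ) + 1) ^ (-1 - θ / 2)) := by
    induction M with
    | zero =>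
      have := hunit 0
      simp only [abs_zero, zero_add, Real.one_rpow, zero_sub] at this
      simp
      have h0 : 0 ≤ 40 * A / θ := by positivity
      norm_num at this
      linarith
    | succ M ih =>
      rw [Finset.sum_range_succ]
      have h3 := intervalIntegral.integral_add_adjacent_intervals
        (hInt (-((M : ℝ) + 1 + 1 / 2)) (-((M : ℝ) + 1 / 2)))
        (hInt (-((M : ℝ) + 1 / 2)) ((M : ℝ) + 1 / 2))
      have h4 := intervalIntegral.integral_add_adjacent_intervals
        (hInt (-((M : ℝ) + 1 + 1 / 2)) ((M : ℝ) + 1 / 2))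
        (hInt ((M : ℝ) + 1 / 2) ((M : ℝ) + 1 + 1 / 2))
      have h1 := hunit (M + 1)
      have h2 := hunit (-(M + 1))
      rw [abs_of_nonneg (by positivity)] at h1
      rw [abs_neg, abs_of_nonneg (by positivity)] at h2
      rw [show (M : ℝ) + 1 - 1 / 2 = M + 1 / 2 by ring] at h1
      rw [show -((M : ℝ) + 1) - 1 / 2 = -(M + 1 + 1 / 2) by ring,
        show -((M : ℝ) + 1) + 1 / 2 = -(M + 1 / 2) by ring] at h2
      push_cast
      linarith
  refine hsum.trans ?_
  rw [← Finset.mul_sum, ← Finset.mul_sum]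
  have h := sum_rpow_neg_one_sub_le (η := θ / 2) (by positivity) M
  have h3 : 1 + 1 / (θ / 2) ≤ 3 / θ := by
    rw [one_div_div, ← sub_nonneg]
    have : 3 / θ - (1 + 2 / θ) = (1 - θ) / θ := by field_simp; ring
    rw [this]
    exact div_nonneg (by linarith) hθ.le
  calc _ ≤ 2 * (40 * A / θ * (3 / θ)) := by
        gcongr
        exact h.trans h3
    _ = _ := by field_simp; ring

theorem le_mul_div_rpow_of_le_of_le {D A B θ : ℝ} (hA : 0 < A) (hB : 0 < B) (hθ0 : 0 ≤ θ)
    (hθ1 : θ ≤ 1) (hDA : D ≤ A) (hDB : D ≤ B) : D ≤ A * (B / A) ^ θ := by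
  rcases le_total 1 (B / A) with h | h
  · have := Real.one_le_rpow h hθ0
    nlinarith
  · have h1 : B / A ≤ (B / A) ^ θ := by
      have := Real.rpow_le_rpow_of_exponent_ge (by positivity) h hθ1
      rwa [Real.rpow_one] at this
    calc D ≤ B := hDB
      _ = A * (B / A) := by field_simp
      _ ≤ _ := by gcongr

theorem norm_cpow_add_one_sub_div_le {X h σ : ℝ} (hX : 0 < X) (hh : 0 < h) (hσ : 0 ≤ σ) {s : ℂ}
    (hs : s.re = σ) :
    ‖((X + h : ℝ) : ℂ) ^ (s + 1) / (s + 1) - (X : ℂ) ^ (s + 1) / (s + 1)‖ ≤ (X + h) ^ σ * h := by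
  have hne : s ≠ -1 := fun hs' ↦ by
    rw [hs'] at hs
    norm_num at hs
    linarith
  have := (convex_Icc X (X + h)).norm_image_sub_le_of_norm_hasDerivWithin_le
    (f := fun y : ℝ ↦ (y : ℂ) ^ (s + 1) / (s + 1)) (f' := fun y : ℝ ↦ (y : ℂ) ^ s)
    (C := (X + h) ^ σ) (x := X) (y := X + h)
    (fun y hy ↦ (hasDerivAt_ofReal_cpow_const' (hX.trans_le hy.1).ne' hne).hasDerivWithinAt)
    (fun y hy ↦ by
      have hy0 : 0 < y := by linarith [hy.1]
      rw [Complex.norm_cpow_eq_rpow_re_of_pos hy0, hs]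
      exact Real.rpow_le_rpow hy0.le hy.2 hσ)
    ⟨le_rfl, by linarith⟩ ⟨by linarith, le_rfl⟩
  refine this.trans (le_of_eq ?_)
  rw [add_sub_cancel_left, Real.norm_of_nonneg hh.le]

theorem norm_cpow_add_one_sub_div_le' {X h σ : ℝ} (hX : 0 < X) (hh : 0 < h) (hσ : 0 ≤ σ) {s : ℂ}
    (hs : s.re = σ) :
    ‖((X + h : ℝ) : ℂ) ^ (s + 1) / (s + 1) - (X : ℂ) ^ (s + 1) / (s + 1)‖
      ≤ 2 * (X + h) ^ (σ + 1) / ‖s + 1‖ := by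
  rw [← sub_div, norm_div]
  gcongr
  refine (norm_sub_le _ _).trans ?_
  rw [Complex.norm_cpow_eq_rpow_re_of_pos hX, Complex.norm_cpow_eq_rpow_re_of_pos (by linarith)]
  simp only [Complex.add_re, hs, Complex.one_re]
  have : X ^ (σ + 1) ≤ (X + h) ^ (σ + 1) := by
    gcongr
    linarith
  linarith

theorem rpow_one_div_log {X : ℝ} (hX : 1 < X) : X ^ (1 / Real.log X) = Real.exp 1 := by
  rw [Real.rpow_def_of_pos (by linarith), mul_one_div_cancel (Real.log_pos hX).ne']

theorem two_le_log_of_nine_le {X : ℝ} (hX : 9 ≤ X) : 2 ≤ Real.log X := by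
  rw [Real.le_log_iff_exp_le (by linarith), show (2 : ℝ) = 1 + 1 by norm_num, Real.exp_add]
  nlinarith [Real.exp_one_lt_d9, Real.exp_pos 1]

theorem norm_perron_kernel_sub_le {X h : ℝ} (hX : 9 ≤ X) (hh1 : 1 ≤ h) (hhX : h ≤ X) {s : ℂ}
    (hs : s.re = 1 / 2 + 1 / Real.log X) :
    ‖((X + h : ℝ) : ℂ) ^ (s + 1) * (s * (s + 1))⁻¹ - (X : ℂ) ^ (s + 1) * (s * (s + 1))⁻¹‖
      ≤ h * (512 * Real.sqrt X) * (1 + |s.im|) ^ (-1 - 1 / Real.log X) := by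
  have hX0 : 0 < X := by linarith
  have hh0 : 0 < h := by linarith
  have hlog := two_le_log_of_nine_le hX
  set θ : ℝ := 1 / Real.log X with hθ
  have hθ0 : 0 < θ := by positivity
  have hθ1 : θ ≤ 1 / 2 := by
    rw [hθ]
    exact one_div_le_one_div_of_le (by norm_num) hlog
  have hXθ : X ^ θ = Real.exp 1 := rpow_one_div_log (by linarith)
  set D := ((X + h : ℝ) : ℂ) ^ (s + 1) / (s + 1) - (X : ℂ) ^ (s + 1) / (s + 1) with hD
  have hs1 : 0 < 1 + |s.im| := by positivity
  have hns : 1 / 4 * (1 + |s.im|) ≤ ‖s‖ := by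
    have := mul_one_add_abs_im_le_norm (d := 1 / 2) (s := s) (by norm_num) (by norm_num) (by linarith)
    linarith
  have hns1 : 1 / 2 * (1 + |s.im|) ≤ ‖s + 1‖ := by
    have := mul_one_add_abs_im_le_norm (d := 1) (s := s + 1) (by norm_num) le_rfl
      (by simp; linarith)
    simpa using this
  have hns1pos : 0 < ‖s + 1‖ := lt_of_lt_of_le (by positivity) hns1
  have hσ : 0 ≤ 1 / 2 + θ := by linarith
  have hpow : 0 < (X + h) ^ (1 / 2 + θ) := by positivity
  have hDle : ‖D‖ ≤ (X + h) ^ (1 / 2 + θ) * h *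
      (2 * (X + h) ^ (1 / 2 + θ + 1) / ‖s + 1‖ / ((X + h) ^ (1 / 2 + θ) * h)) ^ θ :=
    le_mul_div_rpow_of_le_of_le (by positivity) (by positivity) hθ0.le (by linarith)
      (norm_cpow_add_one_sub_div_le hX0 hh0 hσ hs) (norm_cpow_add_one_sub_div_le' hX0 hh0 hσ hs)
  have hratio : 2 * (X + h) ^ (1 / 2 + θ + 1) / ‖s + 1‖ / ((X + h) ^ (1 / 2 + θ) * h)
      ≤ 8 * X * (1 + |s.im|)⁻¹ := by
    rw [Real.rpow_add_one (by linarith)]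
    calc 2 * ((X + h) ^ (1 / 2 + θ) * (X + h)) / ‖s + 1‖ / ((X + h) ^ (1 / 2 + θ) * h)
        = 2 * (X + h) / (‖s + 1‖ * h) := by field_simp
      _ ≤ 2 * (X + X) / (1 / 2 * (1 + |s.im|) * 1) := by gcongr
      _ = _ := by field_simp; ring
  have hratio' : (2 * (X + h) ^ (1 / 2 + θ + 1) / ‖s + 1‖ / ((X + h) ^ (1 / 2 + θ) * h)) ^ θ
      ≤ 8 * Real.exp 1 * (1 + |s.im|) ^ (-θ) := by
    calc _ ≤ (8 * X * (1 + |s.im|)⁻¹) ^ θ := by gcongr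
      _ = 8 ^ θ * X ^ θ * (1 + |s.im|) ^ (-θ) := by
          rw [Real.mul_rpow (by positivity) (by positivity), Real.mul_rpow (by norm_num) hX0.le,
            Real.inv_rpow hs1.le, Real.rpow_neg hs1.le]
      _ ≤ _ := by
          rw [hXθ]
          gcongr
          calc (8 : ℝ) ^ θ ≤ 8 ^ (1 : ℝ) :=
                Real.rpow_le_rpow_of_exponent_le (by norm_num) (by linarith)
            _ = 8 := by norm_num
  have hXh : (X + h) ^ (1 / 2 + θ) ≤ 2 * (Real.sqrt X * Real.exp 1) := by
    calc (X + h) ^ (1 / 2 + θ) ≤ (2 * X) ^ (1 / 2 + θ) := by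
          gcongr
          linarith
      _ = 2 ^ (1 / 2 + θ) * (X ^ (1 / 2 : ℝ) * X ^ θ) := by
          rw [Real.mul_rpow (by norm_num) hX0.le, Real.rpow_add hX0]
      _ ≤ 2 * (Real.sqrt X * Real.exp 1) := by
          rw [hXθ, Real.sqrt_eq_rpow]
          gcongr
          calc (2 : ℝ) ^ (1 / 2 + θ) ≤ 2 ^ (1 : ℝ) :=
                Real.rpow_le_rpow_of_exponent_le (by norm_num) (by linarith)
            _ = 2 := by norm_num
  have hexp : Real.exp 1 * Real.exp 1 ≤ 8 := by
    nlinarith [Real.exp_one_lt_d9, Real.exp_pos 1]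
  have heq : ((X + h : ℝ) : ℂ) ^ (s + 1) * (s * (s + 1))⁻¹ - (X : ℂ) ^ (s + 1) * (s * (s + 1))⁻¹
      = D / s := by
    rw [hD, mul_inv]
    ring
  rw [heq, norm_div]
  calc ‖D‖ / ‖s‖ ≤ (2 * (Real.sqrt X * Real.exp 1) * h * (8 * Real.exp 1 * (1 + |s.im|) ^ (-θ)))
        / (1 / 4 * (1 + |s.im|)) := by
        gcongr
        exact hDle.trans (by gcongr)
    _ = h * (64 * (Real.exp 1 * Real.exp 1) * Real.sqrt X) *
        ((1 + |s.im|) ^ (-θ) * (1 + |s.im|)⁻¹) := by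
        field_simp
        ring
    _ ≤ h * (64 * 8 * Real.sqrt X) * ((1 + |s.im|) ^ (-θ) * (1 + |s.im|)⁻¹) := by gcongr
    _ = _ := by
        rw [← Real.rpow_neg_one, ← Real.rpow_add hs1, show -θ + -1 = -1 - θ by ring]
        norm_num

theorem norm_integral_perron_kernel_sub_mul_le (RH : RiemannHypothesis) {X h : ℝ} (hX : 9 ≤ X)
    (hh1 : 1 ≤ h) {F : ℝ → ℂ} (hF : Integrable F)
    (hFle : ∀ t : ℝ, ‖F t‖ ≤ h * (512 * Real.sqrt X) * ((1 + |t|) ^ (-1 - 1 / Real.log X) *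
      |(logDeriv riemannZeta₁ ((1 / 2 + 1 / Real.log X : ℝ) + t * Complex.I)).re|)) :
    ‖∫ t, F t‖ ≤ h * (786432000 * Real.sqrt X * Real.log X ^ 2) := by
  have hlog : 2 ≤ Real.log X := two_le_log_of_nine_le hX
  have hθ : 0 < 1 / Real.log X := by positivity
  have hθ1 : 1 / Real.log X ≤ 1 / 2 := one_div_le_one_div_of_le (by norm_num) hlog
  set σ : ℝ := 1 / 2 + 1 / Real.log X with hσ
  have hσ2 : 1 / 2 < σ := by linarith
  set f : ℝ → ℝ := fun t ↦ |(logDeriv riemannZeta₁ (σ + t * Complex.I)).re| with hf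
  have hfc : Continuous f :=
    (Complex.continuous_re.comp (continuous_logDeriv_riemannZeta₁_vertical RH hσ2)).abs
  have hM : Tendsto (fun M : ℕ ↦ (M : ℝ) + 1 / 2) atTop atTop :=
    tendsto_atTop_add_const_right _ _ tendsto_natCast_atTop_atTop
  have hlim := (intervalIntegral_tendsto_integral hF
    (tendsto_neg_atTop_atBot.comp hM) hM).norm
  refine le_of_tendsto hlim (Eventually.of_forall fun M ↦ ?_)
  have hweight := integral_weight_le hfc (fun t ↦ abs_nonneg _) (A := 6400) (by norm_num) hθ
    (by linarith) (integral_abs_re_logDeriv_riemannZeta₁_le RH hσ2 (by linarith)) M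
  have hgc : Continuous fun t : ℝ ↦ (1 + |t|) ^ (-1 - 1 / Real.log X) * f t :=
    ((continuous_const.add continuous_abs).rpow_const
      (fun t ↦ Or.inl (by positivity : 1 + |t| ≠ 0))).mul hfc
  calc ‖∫ t in (-((M : ℝ) + 1 / 2))..((M : ℝ) + 1 / 2), F t‖
      ≤ ∫ t in (-((M : ℝ) + 1 / 2))..((M : ℝ) + 1 / 2),
          h * (512 * Real.sqrt X) * ((1 + |t|) ^ (-1 - 1 / Real.log X) * f t) :=
        intervalIntegral.norm_integral_le_of_norm_le (by linarith [M.cast_nonneg (α := ℝ)])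
          (Eventually.of_forall fun t _ ↦ hFle t)
          ((hgc.const_mul _).intervalIntegrable _ _)
    _ = h * (512 * Real.sqrt X) * ∫ t in (-((M : ℝ) + 1 / 2))..((M : ℝ) + 1 / 2),
          (1 + |t|) ^ (-1 - 1 / Real.log X) * f t := intervalIntegral.integral_const_mul _ _
    _ ≤ h * (512 * Real.sqrt X) * (240 * 6400 / (1 / Real.log X) ^ 2) := by gcongr
    _ = _ := by field_simp; ring

theorem abs_sum_vonMangoldt_mul_max_sub_le (RH : RiemannHypothesis) {X h : ℝ} (hX : 9 ≤ X)
    (hh1 : 1 ≤ h) (hhX : h ≤ X) {N : ℕ} (hN : X + h ≤ N + 1) :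
    |∑ n ∈ Finset.Ioc 0 N, ArithmeticFunction.vonMangoldt n *
        (max (X + h - n) 0 - max (X - n) 0) - h * X|
      ≤ h * (786433000 * Real.sqrt X * Real.log X ^ 2 + h) := by
  have hlog : 2 ≤ Real.log X := two_le_log_of_nine_le hX
  have hθ : 0 < 1 / Real.log X := by positivity
  have hθ1 : 1 / Real.log X ≤ 1 / 2 := one_div_le_one_div_of_le (by norm_num) hlog
  set σ : ℝ := 1 / 2 + 1 / Real.log X with hσ
  have hσ2 : 1 / 2 < σ := by linarith
  have hσ1 : σ ≤ 1 := by linarith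
  obtain ⟨hi₁, he₁⟩ := integral_cpow_mul_re_neg_logDeriv_riemannZeta₁ RH (a := X + h)
    (by linarith) hσ2 hσ1 hN
  obtain ⟨hi₂, he₂⟩ := integral_cpow_mul_re_neg_logDeriv_riemannZeta₁ RH (a := X)
    (by linarith) hσ2 hσ1 (N := N) (by linarith)
  have hnorm := norm_integral_perron_kernel_sub_mul_le RH hX hh1 (hi₁.sub hi₂) (fun t ↦ by
    rw [Pi.sub_apply, ← sub_mul, norm_mul, Complex.norm_real, Complex.neg_re, norm_neg,
      Real.norm_eq_abs, ← mul_assoc]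
    gcongr
    have := norm_perron_kernel_sub_le hX hh1 hhX (s := σ + t * Complex.I) (by simp [hσ])
    simpa using this)
  simp only [Pi.sub_apply] at hnorm
  rw [integral_sub hi₁ hi₂, he₁, he₂] at hnorm
  have hG := norm_logDeriv_riemannZeta₁_le RH (σ₀ := 1) (by norm_num) (s := 2 * σ)
    (by simp; linarith) (by simp; linarith)
  have hlog5 : Real.log 5 ≤ 2 := by
    rw [Real.log_le_iff_le_exp (by norm_num)]
    have := Real.exp_one_gt_d9
    rw [show (2 : ℝ) = 1 + 1 by norm_num, Real.exp_add]
    nlinarith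
  have hG' : ‖logDeriv riemannZeta₁ (2 * σ)‖ ≤ 576 := by
    refine hG.trans ?_
    simp only [Complex.mul_im, Complex.re_ofNat, Complex.im_ofNat, Complex.ofReal_re,
      Complex.ofReal_im, mul_zero, zero_mul, add_zero, abs_zero, zero_add]
    norm_num
    linarith
  set G : ℂ := logDeriv riemannZeta₁ (2 * σ) with hGdef
  set S : ℝ := ∑ n ∈ Finset.Ioc 0 N, ArithmeticFunction.vonMangoldt n *
        (max (X + h - n) 0 - max (X - n) 0) with hS
  have hSeq : S = ∑ n ∈ Finset.Ioc 0 N, ArithmeticFunction.vonMangoldt n * max (X + h - n) 0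
      - ∑ n ∈ Finset.Ioc 0 N, ArithmeticFunction.vonMangoldt n * max (X - n) 0 := by
    rw [hS, ← Finset.sum_sub_distrib]
    exact Finset.sum_congr rfl fun n _ ↦ by ring
  have hdiff : (Real.pi * (((∑ n ∈ Finset.Ioc 0 N, ArithmeticFunction.vonMangoldt n *
          max (X + h - n) 0 - (X + h - 1) ^ 2 / 2 : ℝ) : ℂ) + (X + h : ℝ) * -G
          - -logDeriv riemannZeta₁ (2 * σ + 1)) -
      Real.pi * (((∑ n ∈ Finset.Ioc 0 N, ArithmeticFunction.vonMangoldt n *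
          max (X - n) 0 - (X - 1) ^ 2 / 2 : ℝ) : ℂ) + X * -G
          - -logDeriv riemannZeta₁ (2 * σ + 1)) : ℂ)
      = Real.pi * (((S - h * X + h - h ^ 2 / 2 : ℝ) : ℂ) - h * G) := by
    rw [hSeq]
    push_cast
    ring
  rw [hdiff, norm_mul, Complex.norm_real, Real.norm_of_nonneg Real.pi_pos.le] at hnorm
  have hpi := Real.pi_gt_three
  have h1 : ‖((S - h * X + h - h ^ 2 / 2 : ℝ) : ℂ) - h * G‖
      ≤ h * (786432000 * Real.sqrt X * Real.log X ^ 2) := by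
    refine le_trans ?_ hnorm
    exact le_mul_of_one_le_left (norm_nonneg _) (by linarith)
  have h2 : |S - h * X + h - h ^ 2 / 2| ≤
      h * (786432000 * Real.sqrt X * Real.log X ^ 2) + h * 576 := by
    have h3 : ‖(h : ℂ) * G‖ ≤ h * 576 := by
      rw [norm_mul, Complex.norm_real, Real.norm_of_nonneg (by linarith)]
      gcongr
    rw [← Real.norm_eq_abs, ← Complex.norm_real]
    calc ‖((S - h * X + h - h ^ 2 / 2 : ℝ) : ℂ)‖
        = ‖(((S - h * X + h - h ^ 2 / 2 : ℝ) : ℂ) - h * G) + h * G‖ := by rw [sub_add_cancel]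
      _ ≤ _ := (norm_add_le _ _).trans (add_le_add h1 h3)
  have hsX : 1 ≤ Real.sqrt X := Real.one_le_sqrt.2 (by linarith)
  have hbig : 4 ≤ Real.sqrt X * Real.log X ^ 2 := by nlinarith
  have h4 : |S - h * X| ≤ |S - h * X + h - h ^ 2 / 2| + |h ^ 2 / 2 - h| := by
    have := abs_add_le (S - h * X + h - h ^ 2 / 2) (h ^ 2 / 2 - h)
    rwa [show S - h * X + h - h ^ 2 / 2 + (h ^ 2 / 2 - h) = S - h * X by ring] at this
  have h5 : |h ^ 2 / 2 - h| ≤ h * (h + 1) := abs_le.2 ⟨by nlinarith, by nlinarith⟩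
  nlinarith

theorem mul_psi_le_sum_vonMangoldt_mul {X h : ℝ} (hX : 0 ≤ X) (hh : 0 ≤ h) :
    h * Chebyshev.psi X ≤ ∑ n ∈ Finset.Ioc 0 ⌊X + h⌋₊, ArithmeticFunction.vonMangoldt n *
        (max (X + h - n) 0 - max (X - n) 0) := by
  rw [Chebyshev.psi, Finset.mul_sum]
  calc _ = ∑ n ∈ Finset.Ioc 0 ⌊X⌋₊, ArithmeticFunction.vonMangoldt n *
        (max (X + h - n) 0 - max (X - n) 0) := Finset.sum_congr rfl fun n hn ↦ by
          have hn' : (n : ℝ) ≤ X := (Nat.le_floor_iff hX).1 (Finset.mem_Ioc.1 hn).2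
          rw [max_eq_left (by linarith), max_eq_left (by linarith)]
          ring
    _ ≤ _ := Finset.sum_le_sum_of_subset_of_nonneg
          (Finset.Ioc_subset_Ioc_right (Nat.floor_le_floor (by linarith)))
          fun n _ _ ↦ mul_nonneg ArithmeticFunction.vonMangoldt_nonneg
            (sub_nonneg.2 (max_le_max_right _ (by linarith)))

theorem sum_vonMangoldt_mul_le_mul_psi {X h : ℝ} (hh : 0 ≤ h) :
    ∑ n ∈ Finset.Ioc 0 ⌊X + h⌋₊, ArithmeticFunction.vonMangoldt n *
        (max (X + h - n) 0 - max (X - n) 0) ≤ h * Chebyshev.psi (X + h) := by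
  rw [Chebyshev.psi, Finset.mul_sum]
  refine Finset.sum_le_sum fun n _ ↦ ?_
  rw [mul_comm h]
  refine mul_le_mul_of_nonneg_left ?_ ArithmeticFunction.vonMangoldt_nonneg
  rw [sub_le_iff_le_add]
  exact max_le (by linarith [le_max_left (X - n) 0]) (by linarith [le_max_right (X - (n : ℝ)) 0])

theorem abs_psi_sub_le (RH : RiemannHypothesis) {x : ℝ} (hx : 100 ≤ x) :
    |Chebyshev.psi x - x| ≤ 10 ^ 9 * Real.sqrt x * Real.log x ^ 2 := by
  have hx0 : 0 < x := by linarith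
  set h := Real.sqrt x with hh
  have hhx : h * h = x := Real.mul_self_sqrt hx0.le
  have hh10 : 10 ≤ h := Real.le_sqrt_of_sq_le (by linarith)
  have hlog : 2 ≤ Real.log x := two_le_log_of_nine_le (by linarith)
  have hlog4 : 4 ≤ Real.log x ^ 2 := by nlinarith
  have hbig : 4 * h ≤ h * Real.log x ^ 2 := by nlinarith
  have key : ∀ X : ℝ, 9 ≤ X → h ≤ X → X ≤ x →
      |∑ n ∈ Finset.Ioc 0 ⌊X + h⌋₊, ArithmeticFunction.vonMangoldt n *
        (max (X + h - n) 0 - max (X - n) 0) - h * X|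
      ≤ h * (786433000 * h * Real.log x ^ 2 + h) := fun X hX hhX hXx ↦ by
    refine (abs_sum_vonMangoldt_mul_max_sub_le RH hX (by linarith) hhX
      (Nat.lt_floor_add_one _).le).trans ?_
    have : 0 ≤ Real.log X := Real.log_nonneg (by linarith)
    have h1 : Real.sqrt X ≤ h := Real.sqrt_le_sqrt hXx
    have h2 : Real.log X ≤ Real.log x := Real.log_le_log (by linarith) hXx
    gcongr
  rw [abs_le]
  constructor
  · have h1 := (abs_le.1 (key (x - h) (by nlinarith) (by nlinarith) (by linarith))).1
    have h2 := sum_vonMangoldt_mul_le_mul_psi (X := x - h) (h := h) (by linarith)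
    rw [sub_add_cancel] at h1 h2
    have h3 : h * (x - h - (786433000 * h * Real.log x ^ 2 + h)) ≤ h * Chebyshev.psi x := by
      linarith
    have := le_of_mul_le_mul_left h3 (by linarith)
    linarith
  · have h1 := (abs_le.1 (key x (by linarith) (by nlinarith) le_rfl)).2
    have h2 := mul_psi_le_sum_vonMangoldt_mul (X := x) (h := h) hx0.le (by linarith)
    have h3 : h * Chebyshev.psi x ≤ h * (x + (786433000 * h * Real.log x ^ 2 + h)) := by
      linarith
    have := le_of_mul_le_mul_left h3 (by linarith)
    linarith

theorem abs_theta_sub_le (RH : RiemannHypothesis) {x : ℝ} (hx : 2 ≤ x) :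
    |Chebyshev.theta x - x| ≤ 2 * 10 ^ 9 * Real.sqrt x * Real.log x ^ 2 := by
  have hlog2 := Real.log_two_gt_d9
  have hlogx : Real.log 2 ≤ Real.log x := Real.log_le_log (by norm_num) hx
  have hsqrt : 1 ≤ Real.sqrt x := Real.one_le_sqrt.2 (by linarith)
  rcases le_or_gt 100 x with h100 | h100
  · have h1 := abs_psi_sub_le RH h100
    have h2 := Chebyshev.abs_psi_sub_theta_le_sqrt_mul_log (x := x) (by linarith)
    have h3 : |Chebyshev.theta x - x| ≤
        |Chebyshev.psi x - x| + |Chebyshev.psi x - Chebyshev.theta x| := by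
      rw [show Chebyshev.theta x - x = (Chebyshev.psi x - x) -
        (Chebyshev.psi x - Chebyshev.theta x) by ring]
      exact abs_sub _ _
    have hlog : 2 ≤ Real.log x := two_le_log_of_nine_le (by linarith)
    have h4 : Real.sqrt x * Real.log x ≤ Real.sqrt x * Real.log x ^ 2 := by
      gcongr
      nlinarith
    have h5 : 0 ≤ Real.sqrt x * Real.log x := by positivity
    linarith
  · have h1 := Chebyshev.theta_le_log4_mul_x (x := x) (by linarith)
    have h2 := Chebyshev.theta_nonneg x
    have h4 : Real.log 4 ≤ 2 := by
      rw [show (4 : ℝ) = 2 ^ 2 by norm_num, Real.log_pow]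
      have := Real.log_two_lt_d9
      norm_num
      linarith
    have h5 : |Chebyshev.theta x - x| ≤ 100 := abs_le.2 ⟨by linarith, by nlinarith⟩
    have h6 : 0.4 ≤ Real.log x ^ 2 := by nlinarith
    have h7 : 0.4 ≤ Real.sqrt x * Real.log x ^ 2 := by nlinarith
    linarith

theorem integral_one_div_log {x : ℝ} (hx : 2 ≤ x) :
    ∫ t in (2 : ℝ)..x, 1 / Real.log t =
      x / Real.log x - 2 / Real.log 2 + ∫ t in (2 : ℝ)..x, 1 / Real.log t ^ 2 := by
  have hmem : ∀ t ∈ Set.uIcc 2 x, 2 ≤ t := fun t ht ↦ by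
    rw [Set.uIcc_of_le hx] at ht
    exact ht.1
  have hInt₂ : IntervalIntegrable (fun t ↦ 1 / Real.log t ^ 2) volume 2 x :=
    Chebyshev.intervalIntegrable_one_div_log_sq (by norm_num) (by linarith)
  have hInt₁ : IntervalIntegrable (fun t ↦ 1 / Real.log t) volume 2 x := by
    refine ContinuousOn.intervalIntegrable fun t ht ↦ ContinuousAt.continuousWithinAt ?_
    have h2 := hmem t ht
    have : t ≠ 0 := by linarith
    have : Real.log t ≠ 0 := (Real.log_pos (by linarith)).ne'
    fun_prop
  have hftc := intervalIntegral.integral_eq_sub_of_hasDerivAt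
    (f := fun t : ℝ ↦ t / Real.log t) (f' := fun t ↦ 1 / Real.log t - 1 / Real.log t ^ 2)
    (a := 2) (b := x) (fun t ht ↦ by
      have h2 := hmem t ht
      have h0 : t ≠ 0 := by linarith
      have hl : Real.log t ≠ 0 := (Real.log_pos (by linarith)).ne'
      have hd : HasDerivAt (fun t : ℝ ↦ t / Real.log t) _ t :=
        (hasDerivAt_id t).fun_div (Real.hasDerivAt_log h0) hl
      refine hd.congr_deriv ?_
      simp only [id]
      field_simp) (hInt₁.sub hInt₂)
  rw [intervalIntegral.integral_sub hInt₁ hInt₂] at hftc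
  linarith

theorem primeCounting_sub_integral_one_div_log {x : ℝ} (hx : 2 ≤ x) :
    (Nat.primeCounting ⌊x⌋₊ : ℝ) - ∫ t in (2 : ℝ)..x, 1 / Real.log t =
      (Chebyshev.theta x - x) / Real.log x + 2 / Real.log 2 +
        ∫ t in (2 : ℝ)..x, (Chebyshev.theta t - t) / (t * Real.log t ^ 2) := by
  have hInt₁ : IntervalIntegrable (fun t ↦ Chebyshev.theta t / (t * Real.log t ^ 2)) volume 2 x :=
    (intervalIntegrable_iff_integrableOn_Icc_of_le hx).2
      (Chebyshev.integrableOn_theta_div_id_mul_log_sq x)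
  have hInt₂ : IntervalIntegrable (fun t ↦ 1 / Real.log t ^ 2) volume 2 x :=
    Chebyshev.intervalIntegrable_one_div_log_sq (by norm_num) (by linarith)
  have hcongr : ∫ t in (2 : ℝ)..x, (Chebyshev.theta t - t) / (t * Real.log t ^ 2) =
      ∫ t in (2 : ℝ)..x, (Chebyshev.theta t / (t * Real.log t ^ 2) - 1 / Real.log t ^ 2) := by
    refine intervalIntegral.integral_congr fun t ht ↦ ?_
    rw [Set.uIcc_of_le hx] at ht
    have h0 : 0 < t := by linarith [ht.1]
    have hl : 0 < Real.log t := Real.log_pos (by linarith [ht.1])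
    field_simp
  rw [hcongr, intervalIntegral.integral_sub hInt₁ hInt₂, integral_one_div_log hx,
    Chebyshev.primeCounting_eq_theta_div_log_add_integral hx]
  ring

theorem norm_integral_theta_sub_div_le (RH : RiemannHypothesis) {x : ℝ} (hx : 2 ≤ x) :
    ‖∫ t in (2 : ℝ)..x, (Chebyshev.theta t - t) / (t * Real.log t ^ 2)‖
      ≤ 4 * 10 ^ 9 * Real.sqrt x := by
  have hmem : ∀ t ∈ Set.uIcc 2 x, 0 < t := fun t ht ↦ by
    rw [Set.uIcc_of_le hx] at ht
    linarith [ht.1]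
  have hInt : IntervalIntegrable (fun t ↦ 2 * 10 ^ 9 * (Real.sqrt t)⁻¹) volume 2 x := by
    refine ContinuousOn.intervalIntegrable fun t ht ↦ ContinuousAt.continuousWithinAt ?_
    have := (Real.sqrt_pos.2 (hmem t ht)).ne'
    fun_prop
  have hftc := intervalIntegral.integral_eq_sub_of_hasDerivAt
    (f := fun t : ℝ ↦ 4 * 10 ^ 9 * Real.sqrt t) (f' := fun t ↦ 2 * 10 ^ 9 * (Real.sqrt t)⁻¹)
    (a := 2) (b := x) (fun t ht ↦ by
      refine ((Real.hasDerivAt_sqrt (hmem t ht).ne').const_mul (4 * 10 ^ 9)).congr_deriv ?_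
      field_simp
      norm_num) hInt
  refine (intervalIntegral.norm_integral_le_of_norm_le hx (Eventually.of_forall fun t ht ↦ ?_)
    hInt).trans ?_
  · have h0 : 0 < t := by linarith [ht.1]
    have hl : 0 < Real.log t := Real.log_pos (by linarith [ht.1])
    have hs : 0 < Real.sqrt t := Real.sqrt_pos.2 h0
    rw [Real.norm_eq_abs, abs_div, abs_of_pos (show 0 < t * Real.log t ^ 2 by positivity),
      div_le_iff₀ (by positivity)]
    refine (abs_theta_sub_le RH ht.1.le).trans (le_of_eq ?_)
    have hss : t = Real.sqrt t * Real.sqrt t := (Real.mul_self_sqrt h0.le).symm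
    rw [show 2 * 10 ^ 9 * (Real.sqrt t)⁻¹ * (t * Real.log t ^ 2) =
      2 * 10 ^ 9 * ((Real.sqrt t)⁻¹ * t) * Real.log t ^ 2 by ring]
    congr 2
    field_simp
    rw [sq]
    exact hss.symm
  · rw [hftc]
    linarith [Real.sqrt_nonneg 2]

/-- von Koch (1901): on RH, `π(N) − ∫₂^N dx/ln x = O(√N·ln N)`. -/
theorem von_koch (RH : RiemannHypothesis) :
    ∃ C > (0:ℝ), ∃ N₀ : ℝ, ∀ N : ℝ, N₀ ≤ N →
      |(Nat.primeCounting ⌊N⌋₊ : ℝ) - ∫ x in (2:ℝ)..N, 1 / Real.log x|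
        ≤ C * Real.sqrt N * Real.log N := by
  refine ⟨10 ^ 10, by norm_num, 9, fun N hN ↦ ?_⟩
  have h2N : 2 ≤ N := by linarith
  have hlog : 2 ≤ Real.log N := two_le_log_of_nine_le hN
  have hlog2 := Real.log_two_gt_d9
  have hs : 1 ≤ Real.sqrt N := Real.one_le_sqrt.2 (by linarith)
  have h1 : |(Chebyshev.theta N - N) / Real.log N| ≤
      2 * 10 ^ 9 * Real.sqrt N * Real.log N := by
    rw [abs_div, abs_of_pos (by linarith : 0 < Real.log N), div_le_iff₀ (by linarith)]
    exact (abs_theta_sub_le RH h2N).trans (le_of_eq (by ring))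
  have h2 : |2 / Real.log 2| ≤ 4 := by
    rw [abs_of_pos (by positivity), div_le_iff₀ (by linarith)]
    linarith
  have h3 := norm_integral_theta_sub_div_le RH h2N
  rw [Real.norm_eq_abs] at h3
  rw [primeCounting_sub_integral_one_div_log h2N]
  have h4 := (abs_add_three _ _ _).trans (add_le_add_three h1 h2 h3)
  nlinarith
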